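/- arXiv:math/0601430 — 3 statements merged into one kernel-verified Lean document; each statement's English description precedes it below -/
import Mathlib

section
/- Let T : 𝕋 → 𝕋 be the rotation by an irrational α, and let f : 𝕋 → ℝ be absolutely continuous. For each s, sup over 0 ≤ n ≤ q_s and pairs x, y with ‖y − x‖ < 1/q_s of |f^{(n)}(y) − f^{(n)}(x)| tends to 0 as s → ∞, where (q_s) are the denominators of α and f^{(n)}(x) = ∑_{i<n} f(x + iα). -/
open MeasureTheory

/-- `F` is absolutely continuous on `[a,b]`: it is an indefinite integral of an
integrable function. -/
def AbsolutelyContinuousOn (F : ℝ → ℝ) (a b : ℝ) : Prop :=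
  ∃ g : ℝ → ℝ, IntervalIntegrable g volume a b ∧
    ∀ x ∈ Set.Icc a b, F x = F a + ∫ t in a..x, g t

theorem convergent_det_and_sign (α : ℝ) (q₀ q₁ q₂ P₀ P₁ : ℤ) (h₀ : 0 < q₀) (h₁ : q₀ ≤ q₁)
    (h₂ : q₀ + q₁ ≤ q₂)
    (H₀ : 1 / (2 * (q₀ : ℝ) * q₁) < |α - (P₀ : ℝ) / q₀| ∧ |α - (P₀ : ℝ) / q₀| < 1 / ((q₀ : ℝ) * q₁))
    (H₁ : 1 / (2 * (q₁ : ℝ) * q₂) < |α - (P₁ : ℝ) / q₁| ∧ |α - (P₁ : ℝ) / q₁| < 1 / ((q₁ : ℝ) * q₂)) :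
    1 / (2 * (q₁ : ℝ)) < |q₀ * α - P₀| ∧
      ((q₁ * P₀ - q₀ * P₁ = 1 ∧ q₀ * α - P₀ < 0 ∧ 0 < q₁ * α - P₁) ∨
        (q₁ * P₀ - q₀ * P₁ = -1 ∧ 0 < q₀ * α - P₀ ∧ q₁ * α - P₁ < 0)) := by
  have r₀ : (0 : ℝ) < q₀ := by exact_mod_cast h₀
  have r₁ : (0 : ℝ) < q₁ := by exact_mod_cast (by omega : 0 < q₁)
  have r₂ : (0 : ℝ) < q₂ := by exact_mod_cast (by omega : 0 < q₂)
  have h₂r : (q₀ : ℝ) + q₁ ≤ q₂ := by exact_mod_cast h₂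
  have h₁r : (q₀ : ℝ) ≤ q₁ := by exact_mod_cast h₁
  have scale : ∀ (Q : ℝ) (p : ℝ), 0 < Q → |α - p / Q| = |Q * α - p| / Q := by
    intro Q p hQ
    rw [← abs_of_pos hQ, ← abs_div, abs_of_pos hQ]
    congr 1; field_simp
  rw [scale _ _ r₀] at H₀
  rw [scale _ _ r₁] at H₁
  obtain ⟨D₀, hD₀⟩ : ∃ D : ℝ, D = q₀ * α - P₀ := ⟨_, rfl⟩
  obtain ⟨D₁, hD₁⟩ : ∃ D : ℝ, D = q₁ * α - P₁ := ⟨_, rfl⟩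
  rw [← hD₀] at H₀
  rw [← hD₁] at H₁
  have a₀ : 1 < 2 * q₁ * |D₀| := by
    have := H₀.1; field_simp at this; linarith
  have b₀ : q₁ * |D₀| < 1 := by
    have := H₀.2; field_simp at this; linarith
  have b₁ : q₂ * |D₁| < 1 := by
    have := H₁.2; field_simp at this; linarith
  have a₁ : 0 < |D₁| := by
    have := H₁.1
    have h : 0 < |D₁| / q₁ := lt_trans (by positivity) this
    exact (div_pos_iff_of_pos_right r₁).1 h
  have det : ((q₁ * P₀ - q₀ * P₁ : ℤ) : ℝ) = q₀ * D₁ - q₁ * D₀ := by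
    push_cast; rw [hD₀, hD₁]; ring
  have c₁ : q₀ * |D₁| < 1 / 2 := by nlinarith
  rw [← hD₀, ← hD₁]
  refine ⟨by rw [div_lt_iff₀ (by positivity)]; linarith, ?_⟩
  generalize q₁ * P₀ - q₀ * P₁ = e at *
  have e1 : e < 2 := by
    have : (e : ℝ) < 2 := by
      rw [det]; nlinarith [le_abs_self D₁, neg_abs_le D₀]
    exact_mod_cast this
  have e2 : -2 < e := by
    have : (-2 : ℝ) < e := by
      rw [det]; nlinarith [neg_abs_le D₁, le_abs_self D₀]
    exact_mod_cast this
  have e3 : e = -1 ∨ e = 0 ∨ e = 1 := by omega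
  rcases e3 with rfl | rfl | rfl
  · right
    push_cast at det
    have : 0 < D₀ := by
      by_contra! h
      nlinarith [neg_abs_le D₁]
    refine ⟨rfl, this, ?_⟩
    by_contra! h
    rw [abs_of_pos this] at b₀
    nlinarith
  · exfalso
    push_cast at det
    have : q₀ * |D₁| = q₁ * |D₀| := by
      have h := congrArg abs (by linarith : (q₀ : ℝ) * D₁ = q₁ * D₀)
      rwa [abs_mul, abs_mul, abs_of_pos r₀, abs_of_pos r₁] at h
    linarith
  · left
    push_cast at det
    have : D₀ < 0 := by
      by_contra! h
      nlinarith [le_abs_self D₁]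
    refine ⟨rfl, this, ?_⟩
    by_contra! h
    rw [abs_of_neg this] at b₀
    nlinarith

/-- Best approximation: `‖kα‖ ≥ ‖q₀α‖` for `0 < k < q₁`. -/
theorem abs_le_abs_mul_sub_of_lt {α : ℝ} {q₀ q₁ P₀ P₁ : ℤ} (h₀ : 0 < q₀) (h₁ : 0 < q₁)
    (hdet : (q₁ * P₀ - q₀ * P₁ = 1 ∧ q₀ * α - P₀ < 0 ∧ 0 < q₁ * α - P₁) ∨
        (q₁ * P₀ - q₀ * P₁ = -1 ∧ 0 < q₀ * α - P₀ ∧ q₁ * α - P₁ < 0))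
    {k : ℤ} (m : ℤ) (hk : 0 < k) (hkq : k < q₁) : |q₀ * α - P₀| ≤ |k * α - m| := by
  have key : ∃ u v : ℤ, k = u * q₁ + v * q₀ ∧ m = u * P₁ + v * P₀ := by
    rcases hdet with ⟨h, -⟩ | ⟨h, -⟩
    · exact ⟨k * P₀ - m * q₀, m * q₁ - k * P₁, by linear_combination (-k) * h,
        by linear_combination (-m) * h⟩
    · exact ⟨-(k * P₀ - m * q₀), -(m * q₁ - k * P₁), by linear_combination k * h,
        by linear_combination m * h⟩
  obtain ⟨u, v, hku, hmv⟩ := key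
  have hv : v ≠ 0 := by
    rintro rfl
    rcases lt_trichotomy u 0 with h | h | h
    · nlinarith
    · subst h; omega
    · nlinarith
  obtain ⟨D₀, hD₀⟩ : ∃ D : ℝ, D = q₀ * α - P₀ := ⟨_, rfl⟩
  obtain ⟨D₁, hD₁⟩ : ∃ D : ℝ, D = q₁ * α - P₁ := ⟨_, rfl⟩
  rw [← hD₀, ← hD₁] at hdet
  rw [← hD₀]
  have hval : k * α - m = u * D₁ + v * D₀ := by
    rw [hku, hmv, hD₀, hD₁]; push_cast; ring
  rw [hval]
  rcases lt_or_gt_of_ne hv with hv | hv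
  · have hu : 0 ≤ u := by by_contra! h; nlinarith
    have hu' : (0 : ℝ) ≤ u := by exact_mod_cast hu
    have hv' : (v : ℝ) ≤ -1 := by exact_mod_cast (by omega : v ≤ -1)
    rcases hdet with ⟨-, h, h'⟩ | ⟨-, h, h'⟩
    · rw [abs_of_neg h]; refine le_trans ?_ (le_abs_self _); nlinarith
    · rw [abs_of_pos h]; refine le_trans ?_ (neg_le_abs _); nlinarith
  · have hu : u ≤ 0 := by by_contra! h; nlinarith
    have hu' : (u : ℝ) ≤ 0 := by exact_mod_cast hu
    have hv' : (1 : ℝ) ≤ v := by exact_mod_cast (by omega : 1 ≤ v)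
    rcases hdet with ⟨-, h, h'⟩ | ⟨-, h, h'⟩
    · rw [abs_of_neg h]; refine le_trans ?_ (neg_le_abs _); nlinarith
    · rw [abs_of_pos h]; refine le_trans ?_ (le_abs_self _); nlinarith

theorem exists_mem_span_fourier_integral_sub_le (G : ℝ → ℂ) (hG : IntervalIntegrable G volume 0 1)
    {δ : ℝ} (hδ : 0 < δ) :
    ∃ h ∈ Submodule.span ℂ (Set.range (@fourier 1)),
      ∫ t in (0 : ℝ)..1, ‖G t - h (t : UnitAddCircle)‖ ≤ δ := by
  have hmem : MemLp (AddCircle.liftIoc 1 0 G) 1 (volume : Measure UnitAddCircle) := by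
    apply MemLp.memLp_liftIoc
    rw [memLp_one_iff_integrable]
    simpa [IntegrableOn] using (intervalIntegrable_iff_integrableOn_Ioc_of_le zero_le_one).1 hG
  obtain ⟨φ, hφ, hφi⟩ := (memLp_one_iff_integrable.1 hmem).exists_boundedContinuous_integral_sub_le
    (half_pos hδ)
  have hcl : φ.toContinuousMap ∈
      (Submodule.span ℂ (Set.range (@fourier 1))).topologicalClosure := by
    rw [span_fourier_closure_eq_top]; trivial
  obtain ⟨h, hh, hd⟩ := Metric.mem_closure_iff.1 hcl _ (half_pos hδ)
  refine ⟨h, hh, ?_⟩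
  have hhi : Integrable h (volume : Measure UnitAddCircle) :=
    h.continuous.integrable_of_hasCompactSupport (HasCompactSupport.of_compactSpace _)
  have hle : ∫ x : UnitAddCircle, ‖AddCircle.liftIoc 1 0 G x - h x‖ ≤ δ := by
    calc ∫ x : UnitAddCircle, ‖AddCircle.liftIoc 1 0 G x - h x‖
        ≤ ∫ x : UnitAddCircle, (‖AddCircle.liftIoc 1 0 G x - φ x‖ + δ / 2) := by
          refine integral_mono ((memLp_one_iff_integrable.1 hmem).sub hhi).norm
            ((((memLp_one_iff_integrable.1 hmem).sub hφi).norm).add (integrable_const _)) ?_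
          intro x
          have h1 := norm_sub_le_norm_sub_add_norm_sub (AddCircle.liftIoc 1 0 G x) (φ x) (h x)
          have h2 : ‖φ x - h x‖ ≤ δ / 2 := by
            rw [← dist_eq_norm]
            exact (ContinuousMap.dist_apply_le_dist x).trans hd.le
          simp only
          linarith
      _ ≤ δ := by
          have := integral_add (((memLp_one_iff_integrable.1 hmem).sub hφi).norm)
            (integrable_const (δ / 2))
          simp only [Pi.sub_apply, integral_const, smul_eq_mul] at this
          have hv : volume.real (Set.univ : Set (AddCircle (1 : ℝ))) = 1 := by
            simp [measureReal_def]
          rw [hv] at this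
          refine this.le.trans ?_
          linarith
  have := UnitAddCircle.intervalIntegral_preimage 0
    (fun x => ‖AddCircle.liftIoc 1 0 G x - h x‖)
  rw [zero_add] at this
  rw [← this] at hle
  refine le_trans (le_of_eq ?_) hle
  refine intervalIntegral.integral_congr_ae (Filter.Eventually.of_forall fun t ht => ?_)
  rw [Set.uIoc_of_le zero_le_one] at ht
  rw [AddCircle.liftIoc_coe_apply (by simpa using ht)]

theorem exists_bound_birkhoff_sum_of_mem_span_fourier {α : ℝ} (hα : Irrational α)
    {h : C(UnitAddCircle, ℂ)} (hh : h ∈ Submodule.span ℂ (Set.range (@fourier 1))) :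
    ∃ C : ℝ, ∀ (n : ℕ) (x : ℝ), ‖(∑ i ∈ Finset.range n, h ((x + i * α : ℝ) : UnitAddCircle)) -
      n * ∫ t in (0 : ℝ)..1, h (t : UnitAddCircle)‖ ≤ C := by
  have hcont : ∀ g : C(UnitAddCircle, ℂ), Continuous fun t : ℝ => g (t : UnitAddCircle) :=
    fun g => g.continuous.comp (AddCircle.continuous_mk' 1)
  induction hh using Submodule.span_induction with
  | zero => exact ⟨0, by simp⟩
  | add u v _ _ hu hv =>
    obtain ⟨C, hC⟩ := hu
    obtain ⟨D, hD⟩ := hv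
    refine ⟨C + D, fun n x => ?_⟩
    simp only [ContinuousMap.add_apply]
    rw [intervalIntegral.integral_add ((hcont u).intervalIntegrable _ _)
      ((hcont v).intervalIntegrable _ _), Finset.sum_add_distrib, mul_add, add_sub_add_comm]
    exact (norm_add_le _ _).trans (add_le_add (hC n x) (hD n x))
  | smul c u _ hu =>
    obtain ⟨C, hC⟩ := hu
    refine ⟨‖c‖ * C, fun n x => ?_⟩
    simp only [ContinuousMap.smul_apply, smul_eq_mul]
    rw [intervalIntegral.integral_const_mul, ← Finset.mul_sum, mul_left_comm, ← mul_sub, norm_mul]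
    exact mul_le_mul_of_nonneg_left (hC n x) (norm_nonneg _)
  | mem u hu =>
    obtain ⟨k, rfl⟩ := hu
    by_cases hk : k = 0
    · subst hk
      exact ⟨0, by simp⟩
    have hz : ∫ t in (0 : ℝ)..1, fourier k (t : UnitAddCircle) = 0 := by
      have h1 := congrFun (fourierCoeff_fourier (T := 1) k) 0
      rw [fourierCoeff_eq_intervalIntegral _ _ 0] at h1
      simpa [Ne.symm hk, hk] using h1
    set z : ℂ := fourier k (α : UnitAddCircle) with hzdef
    have hz1 : z ≠ 1 := by
      intro h1
      rw [hzdef, fourier_coe_apply, Complex.exp_eq_one_iff] at h1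
      obtain ⟨m, hm⟩ := h1
      have h2 : (k : ℂ) * α = m := by
        have : (2 * Real.pi * Complex.I : ℂ) ≠ 0 := Complex.two_pi_I_ne_zero
        apply mul_left_cancel₀ this
        push_cast at hm
        rw [div_one] at hm
        linear_combination hm
      have h3 : (k : ℝ) * α = m := by exact_mod_cast h2
      exact (hα.intCast_mul hk).ne_int m h3
    refine ⟨2 / ‖z - 1‖, fun n x => ?_⟩
    have hterm : ∀ i : ℕ, fourier k ((x + i * α : ℝ) : UnitAddCircle)
        = fourier k (x : UnitAddCircle) * z ^ i := by
      intro i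
      rw [hzdef, fourier_coe_apply, fourier_coe_apply, fourier_coe_apply, ← Complex.exp_nat_mul,
        ← Complex.exp_add]
      congr 1
      push_cast
      ring
    have hnz : ‖z‖ = 1 := by
      rw [hzdef, fourier_apply]; exact Circle.norm_coe _
    rw [hz, mul_zero, sub_zero, Finset.sum_congr rfl fun i _ => hterm i, ← Finset.mul_sum,
      geom_sum_eq hz1, norm_mul, norm_div]
    have : ‖fourier k (x : UnitAddCircle)‖ = 1 := by
      rw [fourier_apply]; exact Circle.norm_coe _
    rw [this, one_mul]
    gcongr
    refine (norm_sub_le _ _).trans ?_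
    rw [norm_pow, hnz, one_pow, norm_one]
    norm_num

theorem sum_setIntegral_le_mul_setIntegral {X ι : Type*} [MeasurableSpace X] {μ : Measure X}
    {u : X → ℝ} (hu : ∀ x, 0 ≤ u x) {S : Set X} (hi : IntegrableOn u S μ)
    (s : Finset ι) {A : ι → Set X} (hA : ∀ i ∈ s, MeasurableSet (A i)) (hAS : ∀ i ∈ s, A i ⊆ S)
    (K : ℕ) [∀ x, DecidablePred fun i => x ∈ A i]
    (hK : ∀ x, (s.filter fun i => x ∈ A i).card ≤ K) :
    ∑ i ∈ s, ∫ x in A i, u x ∂μ ≤ K * ∫ x in S, u x ∂μ := by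
  have h1 : ∀ i ∈ s, ∫ x in A i, u x ∂μ = ∫ x in S, (A i).indicator u x ∂μ := by
    intro i hi
    rw [setIntegral_indicator (hA i hi), Set.inter_eq_self_of_subset_right (hAS i hi)]
  rw [Finset.sum_congr rfl h1, ← integral_finsetSum _ fun i h => hi.indicator (hA i h),
    ← integral_const_mul]
  refine integral_mono (integrable_finsetSum _ fun i h => hi.indicator (hA i h))
    (hi.const_mul _) fun x => ?_
  classical
  have h2 : ∑ i ∈ s, (A i).indicator u x = (s.filter fun i => x ∈ A i).card * u x := by
    rw [Finset.sum_congr rfl fun i _ => Set.indicator_apply (A i) u x, ← Finset.sum_filter,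
      Finset.sum_const, nsmul_eq_mul]
  simp only [h2]
  exact mul_le_mul_of_nonneg_right (by exact_mod_cast hK x) (hu x)

theorem sum_intervalIntegral_le_of_separated {u : ℝ → ℝ} (hu : ∀ x, 0 ≤ u x)
    (hper : Function.Periodic u 1) (hi : ∀ a b, IntervalIntegrable u volume a b)
    (p : ℕ → ℝ) (n : ℕ) {L d : ℝ} (hL : 0 < L) (hd : 0 ≤ d) (hdL : d ≤ 2 * L) (hd1 : d ≤ 1)
    (hsep : ∀ i < n, ∀ j < n, i ≠ j → ∀ m : ℤ, L ≤ |p i - p j - m|) :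
    ∑ i ∈ Finset.range n, ∫ t in p i..p i + d, u t ≤ 4 * ∫ t in (0 : ℝ)..1, u t := by
  have h1 : ∀ i, ∫ t in p i..p i + d, u t
      = ∫ t in Set.Ioc (Int.fract (p i)) (Int.fract (p i) + d), u t := by
    intro i
    rw [← intervalIntegral.integral_of_le (by linarith)]
    have h2 := intervalIntegral.integral_comp_add_right (a := Int.fract (p i))
      (b := Int.fract (p i) + d) u (⌊p i⌋ : ℝ)
    have h3 : ∀ t, u (t + (⌊p i⌋ : ℝ)) = u t := fun t => by
      have := hper.int_mul ⌊p i⌋ t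
      rwa [mul_one] at this
    simp only [h3] at h2
    rw [h2, add_right_comm, Int.fract_add_floor]
  rw [Finset.sum_congr rfl fun i _ => h1 i]
  classical
  refine (sum_setIntegral_le_mul_setIntegral hu (S := Set.Ioc 0 2)
    ((intervalIntegrable_iff_integrableOn_Ioc_of_le (by norm_num)).1 (hi 0 2)) _
    (fun _ _ => measurableSet_Ioc) (fun i _ => ?_) 2 fun t => ?_).trans ?_
  · refine Set.Ioc_subset_Ioc (Int.fract_nonneg _) ?_
    linarith [Int.fract_lt_one (p i)]
  · refine (Finset.card_le_card_of_injOn (t := Finset.range 2)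
      (fun i => ⌊(Int.fract (p i) - (t - d)) / L⌋₊) ?_ ?_).trans (by simp)
    · intro i h
      simp only [Finset.coe_filter, Set.mem_ofPred_eq, Set.mem_Ioc] at h
      simp only [Finset.coe_range, Set.mem_Iio]
      rw [Nat.floor_lt (div_nonneg (by linarith) hL.le), div_lt_iff₀ hL]
      push_cast
      linarith
    · intro i hi' j hj' hij
      simp only [Finset.coe_filter, Set.mem_ofPred_eq, Set.mem_Ioc, Finset.mem_range] at hi' hj'
      by_contra hne
      have h4 := hsep i hi'.1 j hj'.1 hne (⌊p i⌋ - ⌊p j⌋)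
      have ai : 0 ≤ (Int.fract (p i) - (t - d)) / L := div_nonneg (by linarith) hL.le
      have aj : 0 ≤ (Int.fract (p j) - (t - d)) / L := div_nonneg (by linarith) hL.le
      have b1 := Nat.floor_le ai
      have b2 := Nat.lt_floor_add_one ((Int.fract (p i) - (t - d)) / L)
      have b3 := Nat.floor_le aj
      have b4 := Nat.lt_floor_add_one ((Int.fract (p j) - (t - d)) / L)
      simp only at hij
      rw [hij] at b1 b2
      have c1 : (Int.fract (p i) - (t - d)) / L - (Int.fract (p j) - (t - d)) / L
        = (p i - p j - (⌊p i⌋ - ⌊p j⌋ : ℤ)) / L := by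
        push_cast [Int.fract]; ring
      have c2 : |(p i - p j - (⌊p i⌋ - ⌊p j⌋ : ℤ)) / L| < 1 := by
        rw [← c1, abs_lt]; constructor <;> linarith
      rw [abs_div, abs_of_pos hL, div_lt_one hL] at c2
      linarith
  · rw [← intervalIntegral.integral_of_le (by norm_num),
      ← intervalIntegral.integral_add_adjacent_intervals (hi 0 1) (hi 1 2)]
    have := hper.intervalIntegral_add_eq 1 0
    norm_num at this
    rw [this]
    push_cast
    linarith

/-- A periodic absolutely continuous function is the integral of a periodic function. -/
theorem exists_periodic_density {f : ℝ → ℝ} (hper : ∀ x, f (x + 1) = f x) {g : ℝ → ℝ}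
    (hg : IntervalIntegrable g volume 0 1)
    (hfg : ∀ x ∈ Set.Icc (0 : ℝ) 1, f x = f 0 + ∫ t in (0 : ℝ)..x, g t) :
    ∃ G : ℝ → ℝ, Function.Periodic G 1 ∧ (∀ a b, IntervalIntegrable G volume a b) ∧
      ∫ t in (0 : ℝ)..1, G t = 0 ∧ ∀ x y, f y - f x = ∫ t in x..y, G t := by
  have hP : Function.Periodic (fun t => g (Int.fract t)) 1 := fun t => by simp
  have hae : ∀ x ∈ Set.Icc (0 : ℝ) 1, ∀ᵐ t, t ∈ Set.uIoc 0 x → g t = g (Int.fract t) := by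
    intro x hx
    have h1 : ∀ᵐ t : ℝ, t ≠ 1 := by simp [ae_iff]
    filter_upwards [h1] with t ht htx
    rw [Set.uIoc_of_le hx.1] at htx
    rw [Int.fract_eq_self.2 ⟨htx.1.le, lt_of_le_of_ne (htx.2.trans hx.2) ht⟩]
  have hint01 : IntervalIntegrable (fun t => g (Int.fract t)) volume 0 1 := by
    refine hg.congr_ae ?_
    exact (ae_restrict_iff' measurableSet_uIoc).2 (hae 1 (by simp))
  have hint := hP.intervalIntegrable₀ one_ne_zero hint01
  have hf : ∀ x ∈ Set.Icc (0 : ℝ) 1, f x = f 0 + ∫ t in (0 : ℝ)..x, g (Int.fract t) := by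
    intro x hx
    rw [hfg x hx, intervalIntegral.integral_congr_ae (hae x hx)]
  have hz : ∫ t in (0 : ℝ)..1, g (Int.fract t) = 0 := by
    have h1 := hf 1 (by simp)
    have h2 := hper 0
    rw [zero_add] at h2
    linarith
  have hall : ∀ x, f x = f 0 + ∫ t in (0 : ℝ)..x, g (Int.fract t) := by
    intro x
    have hfr : f x = f (Int.fract x) := by
      have h := Function.Periodic.sub_zsmul_eq (f := f) hper ⌊x⌋ (x := x)
      rw [← h, zsmul_eq_mul, mul_one, Int.self_sub_floor]
    rw [hfr, hf _ ⟨Int.fract_nonneg x, (Int.fract_lt_one x).le⟩,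
      ← intervalIntegral.integral_add_adjacent_intervals (hint 0 (Int.fract x))
        (hint (Int.fract x) x)]
    have h := hP.intervalIntegral_add_zsmul_eq ⌊x⌋ (Int.fract x) hint
    rw [zsmul_eq_mul, mul_one, Int.fract_add_floor, hP.intervalIntegral_add_eq _ 0, zero_add, hz,
      smul_zero] at h
    rw [h, add_zero]
  refine ⟨_, hP, hint, hz, fun x y => ?_⟩
  rw [hall x, hall y, ← intervalIntegral.integral_interval_sub_left (hint 0 y) (hint 0 x)]
  ring

theorem exists_birkhoff_integral_bound {α : ℝ} (hα : Irrational α) {G : ℝ → ℝ}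
    (hP : Function.Periodic G 1) (hint : ∀ a b, IntervalIntegrable G volume a b)
    (hz : ∫ t in (0 : ℝ)..1, G t = 0) {δ : ℝ} (hδ : 0 < δ) :
    ∃ C : ℝ, ∀ (n : ℕ) (x d L : ℝ), 0 < L → 0 ≤ d → d ≤ 2 * L → d ≤ 1 → n * d ≤ 1 →
      (∀ i < n, ∀ j < n, i ≠ j → ∀ m : ℤ, L ≤ |i * α - j * α - m|) →
      |∑ i ∈ Finset.range n, ∫ t in (x + i * α)..(x + i * α + d), G t| ≤ 5 * δ + C * d := by
  have hGi : ∀ a b, IntervalIntegrable (fun t => (G t : ℂ)) volume a b := fun a b =>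
    ⟨(hint a b).1.ofReal, (hint a b).2.ofReal⟩
  obtain ⟨h, hh, hhδ⟩ := exists_mem_span_fourier_integral_sub_le _ (hGi 0 1) hδ
  obtain ⟨C, hC⟩ := exists_bound_birkhoff_sum_of_mem_span_fourier hα hh
  have hcont : Continuous fun t : ℝ => h (t : UnitAddCircle) :=
    h.continuous.comp (AddCircle.continuous_mk' 1)
  have hhi : ∀ a b, IntervalIntegrable (fun t : ℝ => h (t : UnitAddCircle)) volume a b :=
    fun a b => hcont.intervalIntegrable a b
  have hmean : ‖∫ t in (0 : ℝ)..1, h (t : UnitAddCircle)‖ ≤ δ := by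
    have h1 : ∫ t in (0 : ℝ)..1, ((G t : ℂ) - h (t : UnitAddCircle))
        = -∫ t in (0 : ℝ)..1, h (t : UnitAddCircle) := by
      rw [intervalIntegral.integral_sub (hGi 0 1) (hhi 0 1), intervalIntegral.integral_ofReal, hz]
      simp
    rw [← norm_neg, ← h1]
    exact (intervalIntegral.norm_integral_le_integral_norm zero_le_one).trans hhδ
  refine ⟨C, fun n x d L hL hd hdL hd1 hnd hsep => ?_⟩
  have hsplit : ((∑ i ∈ Finset.range n, ∫ t in (x + i * α)..(x + i * α + d), G t : ℝ) : ℂ)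
      = (∑ i ∈ Finset.range n,
          ∫ t in (x + i * α)..(x + i * α + d), ((G t : ℂ) - h (t : UnitAddCircle)))
        + ∫ t in x..(x + d), ∑ i ∈ Finset.range n, h ((t + i * α : ℝ) : UnitAddCircle) := by
    have hshift : ∀ i ∈ Finset.range n, IntervalIntegrable
        (fun t : ℝ => h ((t + i * α : ℝ) : UnitAddCircle)) volume x (x + d) := fun i _ =>
      (hcont.comp (continuous_add_const (i * α))).intervalIntegrable _ _
    rw [intervalIntegral.integral_finsetSum hshift, ← Finset.sum_add_distrib]
    rw [Complex.ofReal_sum]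
    refine Finset.sum_congr rfl fun i _ => ?_
    rw [intervalIntegral.integral_sub (hGi _ _) (hhi _ _), intervalIntegral.integral_ofReal,
      intervalIntegral.integral_comp_add_right (fun t : ℝ => h (t : UnitAddCircle)),
      add_right_comm x d, sub_add_cancel]
  have hfirst : ‖∑ i ∈ Finset.range n,
      ∫ t in (x + i * α)..(x + i * α + d), ((G t : ℂ) - h (t : UnitAddCircle))‖ ≤ 4 * δ := by
    refine (norm_sum_le _ _).trans ?_
    refine (Finset.sum_le_sum fun i _ =>
      intervalIntegral.norm_integral_le_integral_norm (by linarith)).trans ?_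
    refine (sum_intervalIntegral_le_of_separated (fun _ => norm_nonneg _) (fun t => ?_)
      (fun a b => ((hGi a b).sub (hhi a b)).norm) (fun i : ℕ => x + i * α) n hL hd hdL hd1
      fun i hi j hj hij m => ?_).trans (mul_le_mul_of_nonneg_left hhδ (by norm_num))
    · simp only [hP t]
      rw [AddCircle.coe_add_period]
    · rw [add_sub_add_left_eq_sub]
      exact hsep i hi j hj hij m
  have hsecond : ‖∫ t in x..(x + d), ∑ i ∈ Finset.range n, h ((t + i * α : ℝ) : UnitAddCircle)‖
      ≤ δ + C * d := by
    have h1 : ∀ t ∈ Set.uIoc x (x + d),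
        ‖∑ i ∈ Finset.range n, h ((t + i * α : ℝ) : UnitAddCircle)‖ ≤ C + n * δ := by
      intro t _
      have h2 := norm_le_norm_sub_add (∑ i ∈ Finset.range n, h ((t + i * α : ℝ) : UnitAddCircle))
        (n * ∫ t in (0 : ℝ)..1, h (t : UnitAddCircle))
      rw [norm_mul, Complex.norm_natCast] at h2
      exact h2.trans (add_le_add (hC n t) (mul_le_mul_of_nonneg_left hmean n.cast_nonneg))
    refine (intervalIntegral.norm_integral_le_of_norm_le_const h1).trans ?_
    rw [add_sub_cancel_left, abs_of_nonneg hd]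
    nlinarith
  rw [← Real.norm_eq_abs, ← Complex.norm_real, hsplit]
  exact (norm_add_le _ _).trans (by linarith)

/-- For an irrational rotation by `α` with denominators `(q_s)` and an absolutely
continuous `f : 𝕋 → ℝ` (modelled as a `1`-periodic function on `ℝ`),
`sup_{0 ≤ n ≤ q_s} sup_{‖y-x‖ < 1/q_s} |f^{(n)}(y) - f^{(n)}(x)| → 0` as `s → ∞`. -/
theorem stmt_8 (α : ℝ) (hα : Irrational α) (a q : ℕ → ℕ) (P : ℕ → ℤ)
    (ha : ∀ n, 1 ≤ n → 1 ≤ a n)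
    (hq0 : q 0 = 1) (hq1 : q 1 = a 1)
    (hqrec : ∀ n, 1 ≤ n → q (n + 1) = a (n + 1) * q n + q (n - 1))
    (happrox : ∀ n, 1 ≤ n →
      1 / (2 * (q n : ℝ) * q (n + 1)) < |α - (P n : ℝ) / q n| ∧
        |α - (P n : ℝ) / q n| < 1 / ((q n : ℝ) * q (n + 1)))
    (hround : ∀ n, 1 ≤ n → round ((q n : ℝ) * α) = P n)
    (f : ℝ → ℝ) (hper : ∀ x, f (x + 1) = f x)
    (hac : AbsolutelyContinuousOn f 0 1) :
    ∀ ε : ℝ, 0 < ε → ∃ s₀ : ℕ, ∀ s, s₀ ≤ s →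
      ∀ n ≤ q s, ∀ x y : ℝ, |y - x - round (y - x)| < 1 / (q s : ℝ) →
        |(∑ i ∈ Finset.range n, f (y + i * α)) - ∑ i ∈ Finset.range n, f (x + i * α)| < ε := by
  intro ε hε
  obtain ⟨g, hg, hfg⟩ := hac
  obtain ⟨G, hP, hint, hz, hfG⟩ := exists_periodic_density hper hg hfg
  obtain ⟨C, hC⟩ := exists_birkhoff_integral_bound hα hP hint hz (δ := ε / 10) (by linarith)
  have hqpos : ∀ n, 1 ≤ q n ∧ 1 ≤ q (n + 1) := by
    intro n
    induction n with
    | zero => exact ⟨hq0.ge, hq1 ▸ ha 1 le_rfl⟩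
    | succ n ih =>
      refine ⟨ih.2, ?_⟩
      rw [hqrec (n + 1) (by omega), Nat.add_sub_cancel]
      exact ih.1.trans (Nat.le_add_left _ _)
  have hqge : ∀ n, q n + q (n + 1) ≤ q (n + 1 + 1) := by
    intro n
    rw [hqrec (n + 1) (by omega), Nat.add_sub_cancel]
    have := Nat.le_mul_of_pos_left (q (n + 1)) (ha (n + 1 + 1) (by omega))
    omega
  have hqlin : ∀ n, n ≤ q n := by
    intro n
    induction n with
    | zero => exact Nat.zero_le _
    | succ n ih =>
      rcases n with _ | n
      · exact (hqpos 0).2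
      · have := hqge n
        have := (hqpos n).1
        omega
  have hqmono : ∀ n, q n ≤ q (n + 1) := by
    intro n
    rcases n with _ | n
    · rw [hq0]; exact (hqpos 0).2
    · have := hqge n
      omega
  obtain ⟨N, hN⟩ := exists_nat_gt (2 * C / ε)
  refine ⟨N + 2, fun s hs n hn => ?_⟩
  have hqs : (0 : ℝ) < q s := by exact_mod_cast (hqpos s).1
  have hsep : ∀ i < n, ∀ j < n, i ≠ j → ∀ m : ℤ,
      1 / (2 * (q s : ℝ)) ≤ |i * α - j * α - m| := by
    obtain ⟨r, rfl⟩ : ∃ r, s = r + 2 := ⟨s - 2, by omega⟩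
    have hdet := convergent_det_and_sign α (q (r + 1)) (q (r + 2)) (q (r + 3)) (P (r + 1))
      (P (r + 2)) (by exact_mod_cast (hqpos r).2) (by exact_mod_cast hqmono (r + 1))
      (by exact_mod_cast hqge (r + 1)) (by simpa using happrox (r + 1) (by omega))
      (by simpa using happrox (r + 2) (by omega))
    have hlt : ∀ i < n, ∀ j < i, ∀ m : ℤ,
        1 / (2 * (q (r + 2) : ℝ)) ≤ |i * α - j * α - m| := by
      intro i hi j hj m
      have h1 := abs_le_abs_mul_sub_of_lt (by exact_mod_cast (hqpos r).2)
        (by exact_mod_cast (hqpos (r + 1)).2) hdet.2 (k := (i : ℤ) - j) m (by omega) (by omega)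
      have h2 := hdet.1.le.trans h1
      push_cast at h2
      rwa [sub_mul] at h2
    intro i hi j hj hij m
    rcases lt_or_gt_of_ne hij with h | h
    · have h1 := hlt j hj i h (-m)
      rw [← abs_neg] at h1
      convert h1 using 2
      push_cast
      ring
    · exact hlt i hi j h m
  have hfper : Function.Periodic f 1 := hper
  have hmain : ∀ x d : ℝ, 0 ≤ d → d < 1 / (q s : ℝ) →
      |(∑ i ∈ Finset.range n, f (x + i * α + d)) - ∑ i ∈ Finset.range n, f (x + i * α)| < ε := by
    intro x d hd hdq
    rw [← Finset.sum_sub_distrib]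
    simp only [hfG]
    have hdq' : q s * d ≤ 1 := by
      rw [lt_div_iff₀ hqs] at hdq
      linarith
    have hn' : (n : ℝ) ≤ q s := by exact_mod_cast hn
    have hq1' : (1 : ℝ) ≤ q s := by exact_mod_cast (hqpos s).1
    refine (hC n x d (1 / (2 * q s)) (by positivity) hd ?_ (by nlinarith) (by nlinarith)
      hsep).trans_lt ?_
    · refine hdq.le.trans (le_of_eq ?_)
      field_simp
    · have h1 : C * d < ε / 2 := by
        have hsq : (N : ℝ) ≤ q s := by exact_mod_cast (by have := hqlin s; omega : N ≤ q s)
        have h2 : 2 * C < q s * ε := by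
          rw [div_lt_iff₀ hε] at hN
          nlinarith
        rcases hd.eq_or_lt with rfl | hd
        · simpa using hε
        · nlinarith
      linarith
  intro x y hxy
  set e := y - x - round (y - x) with he
  have hy : ∀ i : ℕ, f (y + i * α) = f (x + i * α + e) := by
    intro i
    have h := hfper.sub_zsmul_eq (round (y - x)) (x := y + i * α)
    rw [← h, he, zsmul_eq_mul, mul_one]
    congr 1
    ring
  rcases le_total 0 e with h0 | h0
  · rw [abs_of_nonneg h0] at hxy
    rw [Finset.sum_congr rfl fun i _ => hy i]
    exact hmain x e h0 hxy
  · rw [abs_of_nonpos h0] at hxy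
    have h1 := hmain (x + e) (-e) (by linarith) hxy
    rw [abs_sub_comm]
    convert h1 using 3
    · exact Finset.sum_congr rfl fun i _ => by congr 1; ring
    · exact Finset.sum_congr rfl fun i _ => by rw [hy i]; congr 1; ring
end

section
/- Let α be irrational with bounded partial quotients, C = sup a_n + 1, and f : 𝕋 → ℝ absolutely continuous. Then sup over 0 ≤ n ≤ q_{s+1} and ‖y − x‖ < 1/q_s of |f^{(n)}(y) − f^{(n)}(x)| tends to 0 as s → ∞. -/
open MeasureTheory

/-- A family of `δ`-separated points (mod `1`) covers each point of the circle at most `K` times by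
arcs of length `L ≤ K * δ`, which bounds the sum of the integrals of `w ≥ 0` over these arcs. -/
theorem sum_integral_le_of_separated {w : ℝ → ℝ} (hw : Function.Periodic w 1) (hw0 : ∀ t, 0 ≤ w t)
    (hwi : ∀ x y, IntervalIntegrable w volume x y) {n K : ℕ} {u : ℕ → ℝ} {δ L : ℝ} (hδ : 0 < δ)
    (hL0 : 0 ≤ L) (hL1 : L ≤ 1) (hLK : L ≤ K * δ)
    (hu : ∀ i < n, ∀ j < n, i ≠ j → ∀ m : ℤ, δ ≤ |u i - u j - m|) :
    ∑ i ∈ Finset.range n, ∫ t in u i..u i + L, w t ≤ K * ∫ t in (0 : ℝ)..1, w t := by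
  set A : ℕ → Set ℝ := fun i => {t | Int.fract (t - u i) < L} with hA
  have hAm : ∀ i, MeasurableSet (A i) := fun i =>
    measurableSet_lt (measurable_fract.comp (measurable_id.sub_const _)) measurable_const
  have hint : ∀ i x y, IntervalIntegrable ((A i).indicator w) volume x y := fun i x y =>
    ⟨(hwi x y).1.indicator (hAm i), (hwi x y).2.indicator (hAm i)⟩
  have hAper : ∀ i, Function.Periodic ((A i).indicator w) 1 := by
    intro i t
    have h : t + 1 ∈ A i ↔ t ∈ A i := by
      simp only [hA, Set.mem_ofPred_eq]
      rw [show t + 1 - u i = (t - u i) + 1 by ring, Int.fract_add_one]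
    by_cases ht : t ∈ A i
    · rw [Set.indicator_of_mem ht, Set.indicator_of_mem (h.2 ht), hw]
    · rw [Set.indicator_of_notMem ht, Set.indicator_of_notMem (fun h' => ht (h.1 h'))]
  have hterm : ∀ i, ∫ t in u i..u i + L, w t ≤ ∫ t in (0 : ℝ)..1, (A i).indicator w t := by
    intro i
    have h1 := (hAper i).intervalIntegral_add_eq 0 (u i)
    rw [zero_add] at h1
    rw [h1, ← intervalIntegral.integral_add_adjacent_intervals
      (hint i (u i) (u i + L)) (hint i (u i + L) (u i + 1))]
    have h2 : ∫ t in u i..u i + L, w t = ∫ t in u i..u i + L, (A i).indicator w t := by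
      rw [intervalIntegral.integral_of_le (by linarith), intervalIntegral.integral_of_le (by linarith),
        integral_Ioc_eq_integral_Ioo, integral_Ioc_eq_integral_Ioo]
      refine setIntegral_congr_fun measurableSet_Ioo fun t ht => ?_
      have : t ∈ A i := by
        simp only [hA, Set.mem_ofPred_eq]
        rw [Int.fract_eq_self.2 ⟨by linarith [ht.1], by linarith [ht.2]⟩]
        linarith [ht.2]
      simp only [Set.indicator_of_mem this]
    rw [h2]
    have := intervalIntegral.integral_nonneg (μ := volume) (show u i + L ≤ u i + 1 by linarith)
      (f := (A i).indicator w) (fun t _ => Set.indicator_nonneg (fun t _ => hw0 t) t)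
    linarith
  refine (Finset.sum_le_sum fun i _ => hterm i).trans ?_
  rw [← intervalIntegral.integral_finsetSum fun i _ => hint i 0 1,
    ← intervalIntegral.integral_const_mul]
  refine intervalIntegral.integral_mono_on zero_le_one ?_ ((hwi 0 1).const_mul _) ?_
  · have := IntervalIntegrable.sum (f := fun i => (A i).indicator w) (Finset.range n)
      (fun i _ => hint i 0 1)
    rwa [Finset.sum_fn] at this
  intro t _
  classical
  simp only [Set.indicator_apply, ← Finset.sum_filter, Finset.sum_const, nsmul_eq_mul]
  refine mul_le_mul_of_nonneg_right ?_ (hw0 t)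
  have hcard : ((Finset.range n).filter (fun i => t ∈ A i)).card ≤ (Finset.range K).card := by
    refine Finset.card_le_card_of_injOn (fun i => ⌊Int.fract (t - u i) / δ⌋₊) ?_ ?_
    · intro i hi
      simp only [Finset.coe_filter, Set.mem_ofPred_eq, hA] at hi
      simp only [Finset.coe_range, Set.mem_Iio]
      rw [Nat.floor_lt (div_nonneg (Int.fract_nonneg _) hδ.le), div_lt_iff₀ hδ]
      linarith [hi.2]
    · intro i hi j hj hij
      simp only [Finset.coe_filter, Set.mem_ofPred_eq, Finset.mem_range] at hi hj
      by_contra hne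
      have h1 := hu i hi.1 j hj.1 hne (⌊t - u j⌋ - ⌊t - u i⌋)
      have hij' : ⌊Int.fract (t - u i) / δ⌋₊ = ⌊Int.fract (t - u j) / δ⌋₊ := hij
      have e1 := Nat.floor_le (div_nonneg (Int.fract_nonneg (t - u i)) hδ.le)
      have e2 := Nat.lt_floor_add_one (Int.fract (t - u i) / δ)
      have e3 := Nat.floor_le (div_nonneg (Int.fract_nonneg (t - u j)) hδ.le)
      have e4 := Nat.lt_floor_add_one (Int.fract (t - u j) / δ)
      rw [hij'] at e1 e2
      have h2 : |Int.fract (t - u j) / δ - Int.fract (t - u i) / δ| < 1 := by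
        rw [abs_lt]; constructor <;> linarith
      rw [← sub_div, abs_div, abs_of_pos hδ, div_lt_one hδ] at h2
      have h3 : u i - u j - ((⌊t - u j⌋ - ⌊t - u i⌋ : ℤ) : ℝ)
          = Int.fract (t - u j) - Int.fract (t - u i) := by
        rw [Int.fract, Int.fract]; push_cast; ring
      rw [h3] at h1
      linarith
  simpa using hcard

/-- Over an irrational rotation, constants plus continuous coboundaries are dense in `L¹`. -/
theorem exists_coboundary_near {α : ℝ} (hα : Irrational α) {G : UnitAddCircle → ℂ}
    (hG : Integrable G) {ε : ℝ} (hε : 0 < ε) :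
    ∃ (c : ℂ) (p ψ : C(UnitAddCircle, ℂ)),
      (∀ t, p t = c + (ψ (t + (α : UnitAddCircle)) - ψ t)) ∧ ∫ t, ‖G t - p t‖ ≤ ε := by
  obtain ⟨h, hh, hhi⟩ := hG.exists_boundedContinuous_integral_sub_le (half_pos hε)
  have hmem : h.toContinuousMap ∈
      (Submodule.span ℂ (Set.range (@fourier 1))).topologicalClosure := by
    rw [span_fourier_closure_eq_top]; trivial
  obtain ⟨p, hp, hdist⟩ := Metric.mem_closure_iff.1 hmem (ε / 2) (half_pos hε)
  have hcob : ∃ (c : ℂ) (ψ : C(UnitAddCircle, ℂ)),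
      ∀ t, p t = c + (ψ (t + (α : UnitAddCircle)) - ψ t) := by
    refine Submodule.span_induction (p := fun (p : C(UnitAddCircle, ℂ)) _ =>
      ∃ (c : ℂ) (ψ : C(UnitAddCircle, ℂ)), ∀ t, p t = c + (ψ (t + (α : UnitAddCircle)) - ψ t))
      ?_ ?_ ?_ ?_ hp
    · rintro _ ⟨k, rfl⟩
      by_cases hk : k = 0
      · exact ⟨1, 0, fun t => by simp [hk]⟩
      · have hne : fourier k (α : UnitAddCircle) - 1 ≠ 0 := by
          rw [sub_ne_zero, fourier_coe_apply]
          intro h1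
          obtain ⟨m, hm⟩ := Complex.exp_eq_one_iff.1 h1
          have hpi := Complex.two_pi_I_ne_zero
          have : (k : ℂ) * α = m := by
            apply mul_left_cancel₀ hpi
            push_cast at hm
            linear_combination hm
          have h2 : (k : ℝ) * α = m := by exact_mod_cast this
          exact (hα.intCast_mul hk).ne_int m h2
        refine ⟨0, (fourier k (α : UnitAddCircle) - 1)⁻¹ • fourier k, fun t => ?_⟩
        have : fourier k (t + (α : UnitAddCircle)) = fourier k t * fourier k (α : UnitAddCircle) := by
          simp [fourier_apply, AddCircle.toCircle_add]
        simp only [ContinuousMap.smul_apply, smul_eq_mul, this]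
        field_simp
        ring
    · exact ⟨0, 0, fun t => by simp⟩
    · rintro x y _ _ ⟨c, ψ, h1⟩ ⟨d, φ, h2⟩
      exact ⟨c + d, ψ + φ, fun t => by simp [h1, h2]; ring⟩
    · rintro a x _ ⟨c, ψ, h1⟩
      exact ⟨a * c, a • ψ, fun t => by simp [h1]; ring⟩
  obtain ⟨c, ψ, hψ⟩ := hcob
  refine ⟨c, p, ψ, hψ, ?_⟩
  have hpi : Integrable p := p.continuous.integrable_of_hasCompactSupport
    (HasCompactSupport.of_compactSpace _)
  have hle : ∀ t, ‖G t - p t‖ ≤ ‖G t - h t‖ + ε / 2 := fun t => by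
    have h1 : ‖h t - p t‖ ≤ ε / 2 := by
      rw [← dist_eq_norm]
      exact (ContinuousMap.dist_apply_le_dist (f := h.toContinuousMap) (g := p) t).trans hdist.le
    calc _ = ‖(G t - h t) + (h t - p t)‖ := by ring_nf
      _ ≤ _ := (norm_add_le _ _).trans (by gcongr)
  calc _ ≤ ∫ t, (‖G t - h t‖ + ε / 2) :=
        integral_mono (hG.sub hpi).norm ((hG.sub hhi).norm.add (integrable_const _)) hle
    _ = (∫ t, ‖G t - h t‖) + ε / 2 := by
        have hi : Integrable fun t => ‖G t - h t‖ := (hG.sub hhi).norm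
        rw [integral_add hi (integrable_const _)]; simp [Measure.real]
    _ ≤ ε := by linarith

/-- Growth of the continued fraction denominators when the partial quotients are less than `C`. -/
theorem denominators_bounds {a q : ℕ → ℕ} {C : ℕ} (ha : ∀ n, 1 ≤ n → 1 ≤ a n)
    (haC : ∀ n, a n < C) (hq0 : q 0 = 1) (hq1 : q 1 = a 1)
    (hqrec : ∀ n, 1 ≤ n → q (n + 1) = a (n + 1) * q n + q (n - 1)) (n : ℕ) :
    n + 1 ≤ q (n + 1) ∧ 1 ≤ q n ∧ q n ≤ q (n + 1) ∧ q (n + 1) ≤ C * q n := by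
  induction n with
  | zero =>
    have := ha 1 le_rfl
    have := haC 1
    simp only [hq0, zero_add, hq1]
    omega
  | succ n ih =>
    obtain ⟨h1, h2, h3, h4⟩ := ih
    have hr : q (n + 1 + 1) = a (n + 1 + 1) * q (n + 1) + q n := hqrec (n + 1) (by omega)
    have hge : q (n + 1) ≤ a (n + 1 + 1) * q (n + 1) :=
      Nat.le_mul_of_pos_left _ (ha (n + 1 + 1) (by omega))
    have hle : (a (n + 1 + 1) + 1) * q (n + 1) ≤ C * q (n + 1) :=
      Nat.mul_le_mul_right _ (haC (n + 1 + 1))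
    rw [add_mul, one_mul] at hle
    exact ⟨by omega, by omega, by omega, by omega⟩

/-- A lower bound for `|k * α - m|` from an approximation `P / q` of `α` with next denominator
`r ≥ 2 * k`. -/
theorem abs_mul_sub_ge {α : ℝ} {k m P : ℤ} {q r : ℕ} (hk : 0 < k) (hq : 1 ≤ q)
    (hr : 1 ≤ r) (hkr : 2 * k ≤ r)
    (hP1 : 1 / (2 * (q : ℝ) * r) < |α - (P : ℝ) / q|)
    (hP2 : |α - (P : ℝ) / q| < 1 / ((q : ℝ) * r)) :
    (k : ℝ) / (2 * q * r) ≤ |k * α - m| := by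
  have hk' : (0 : ℝ) < k := by exact_mod_cast hk
  have hq' : (0 : ℝ) < q := by exact_mod_cast hq
  have hr' : (0 : ℝ) < r := by exact_mod_cast hr
  have hkr' : 2 * (k : ℝ) ≤ r := by exact_mod_cast hkr
  by_cases h : m * q = P * k
  · have h' : (m : ℝ) * q = P * k := by exact_mod_cast h
    have : (k : ℝ) * α - m = k * (α - P / q) := by field_simp; linear_combination -h'
    rw [this, abs_mul, abs_of_pos hk']
    calc (k : ℝ) / (2 * q * r) = k * (1 / (2 * q * r)) := by ring
      _ ≤ _ := by gcongr
  · have h1 : (1 : ℝ) ≤ |(P * k - m * q : ℤ)| := by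
      exact_mod_cast Int.one_le_abs (sub_ne_zero.2 (Ne.symm h))
    rw [Int.cast_abs] at h1
    have h2 : (k : ℝ) * α - m = k * (α - P / q) + (P * k - m * q : ℤ) / q := by
      push_cast; field_simp; ring
    have h3 : |((P * k - m * q : ℤ) : ℝ) / q| ≤ |k * α - m| + |k * (α - P / q)| := by
      calc _ = |(k * α - m) - k * (α - P / q)| := by rw [h2]; ring_nf
        _ ≤ _ := abs_sub _ _
    rw [abs_div, abs_of_pos hq', abs_mul, abs_of_pos hk'] at h3
    have h4 : 1 / (q : ℝ) ≤ |((P * k - m * q : ℤ) : ℝ)| / q := by gcongr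
    have h5 : k * |α - P / q| ≤ k * (1 / ((q : ℝ) * r)) := by gcongr
    have h6 : (k : ℝ) / (2 * q * r) + k * (1 / ((q : ℝ) * r)) ≤ 1 / q := by
      rw [show (k : ℝ) / (2 * q * r) + k * (1 / ((q : ℝ) * r)) = (3 * k / (2 * r)) * (1 / q) by
        field_simp; ring]
      apply mul_le_of_le_one_left (by positivity)
      rw [div_le_one (by positivity)]
      linarith
    linarith

/-- A number with bounded partial quotients is badly approximable. -/
theorem abs_mul_sub_ge_of_bounded {α : ℝ} {a q : ℕ → ℕ} {P : ℕ → ℤ} {C : ℕ}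
    (ha : ∀ n, 1 ≤ n → 1 ≤ a n) (haC : ∀ n, a n < C) (hq0 : q 0 = 1) (hq1 : q 1 = a 1)
    (hqrec : ∀ n, 1 ≤ n → q (n + 1) = a (n + 1) * q n + q (n - 1))
    (happrox : ∀ n, 1 ≤ n →
      1 / (2 * (q n : ℝ) * q (n + 1)) < |α - (P n : ℝ) / q n| ∧
        |α - (P n : ℝ) / q n| < 1 / ((q n : ℝ) * q (n + 1)))
    {k : ℤ} (hk : 0 < k) (m : ℤ) :
    1 / (8 * (C : ℝ) ^ 3 * k) ≤ |k * α - m| := by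
  have hb := denominators_bounds ha haC hq0 hq1 hqrec
  have hC : 1 ≤ C := by have := haC 0; omega
  have hex : ∃ r, 2 * k ≤ q (r + 1 + 1) :=
    ⟨(2 * k).toNat, by have := (hb ((2 * k).toNat + 1)).1; omega⟩
  set r := Nat.find hex
  have hr1 : 2 * k ≤ q (r + 1 + 1) := Nat.find_spec hex
  have hqr : (q (r + 1) : ℤ) ≤ 2 * k * C := by
    rcases Nat.eq_zero_or_pos r with h0 | h0
    · rw [h0, zero_add, hq1]
      have := haC 1
      nlinarith
    · have := Nat.find_min hex (m := r - 1) (by omega)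
      rw [Nat.sub_add_cancel h0] at this
      nlinarith
  refine le_trans ?_ (abs_mul_sub_ge hk (hb (r + 1)).2.1 (hb (r + 1 + 1)).2.1 hr1
    (happrox (r + 1) (by omega)).1 (happrox (r + 1) (by omega)).2)
  have hk' : (0 : ℝ) < k := by exact_mod_cast hk
  have hC' : (0 : ℝ) < C := by exact_mod_cast hC
  have h1 : (q (r + 1) : ℝ) ≤ 2 * k * C := by exact_mod_cast hqr
  have h2 : (q (r + 1 + 1) : ℝ) ≤ C * q (r + 1) := by exact_mod_cast (hb (r + 1)).2.2.2
  have h3 : (0 : ℝ) < q (r + 1) := by exact_mod_cast (hb (r + 1)).2.1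
  have h4 : (0 : ℝ) < q (r + 1 + 1) := by exact_mod_cast (hb (r + 1 + 1)).2.1
  have h5 : (q (r + 1) : ℝ) * q (r + 1 + 1) ≤ (2 * k * C) * (C * (2 * k * C)) := by
    gcongr
    exact h2.trans (by gcongr)
  rw [div_le_div_iff₀ (by positivity) (by positivity)]
  nlinarith

/-- The increments of an absolutely continuous periodic function are integrals of a mean-zero
integrable function on the circle. -/
theorem exists_integrable_increment_eq_integral {f g : ℝ → ℝ} (hper : ∀ x, f (x + 1) = f x)
    (hg : IntervalIntegrable g volume 0 1)
    (hfg : ∀ x ∈ Set.Icc (0 : ℝ) 1, f x = f 0 + ∫ t in (0 : ℝ)..x, g t) :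
    ∃ G : UnitAddCircle → ℂ, Integrable G ∧ (∫ t, G t) = 0 ∧
      ∀ x y : ℝ, ((f y - f x : ℝ) : ℂ) = ∫ t in x..y, G t := by
  set G : UnitAddCircle → ℂ := AddCircle.liftIoc 1 0 (fun t => (g t : ℂ)) with hG
  have hGi : Integrable G := by
    rw [← memLp_one_iff_integrable]
    apply MemLp.memLp_liftIoc
    rw [memLp_one_iff_integrable, zero_add]
    exact ((intervalIntegrable_iff_integrableOn_Ioc_of_le zero_le_one).1 hg).ofReal
  have hGper : Function.Periodic (fun t : ℝ => G t) 1 := fun t => by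
    simp only [AddCircle.coe_add_period]
  have hGint : ∀ x y : ℝ, IntervalIntegrable (fun t : ℝ => G t) volume x y := by
    refine hGper.intervalIntegrable (t := 0) one_ne_zero ?_
    rw [intervalIntegrable_iff_integrableOn_Ioc_of_le (by norm_num)]
    exact (UnitAddCircle.measurePreserving_mk 0).integrable_comp_of_integrable hGi
  have hunit : ∀ x ∈ Set.Icc (0 : ℝ) 1, ∫ t in (0 : ℝ)..x, G t = ((f x - f 0 : ℝ) : ℂ) := by
    intro x hx
    rw [hfg x hx, add_sub_cancel_left, ← intervalIntegral.integral_ofReal]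
    refine intervalIntegral.integral_congr_ae (.of_forall fun t ht => ?_)
    rw [Set.uIoc_of_le hx.1] at ht
    rw [hG, AddCircle.liftIoc_coe_apply ⟨ht.1, by linarith [ht.2, hx.2]⟩]
  have hzero : ∫ t in (0 : ℝ)..1, G t = 0 := by
    rw [hunit 1 (by simp)]
    have := hper 0
    rw [zero_add] at this
    simp [this]
  have hfper : Function.Periodic f 1 := hper
  have hfrom : ∀ x : ℝ, ∫ t in (0 : ℝ)..x, G t = ((f x - f 0 : ℝ) : ℂ) := by
    intro x
    have h1 := hGper.intervalIntegral_add_zsmul_eq ⌊x⌋ (Int.fract x) hGint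
    have h2 := hGper.intervalIntegral_add_eq (Int.fract x) 0
    rw [zero_add] at h2
    rw [h2, hzero, smul_zero, zsmul_one, Int.fract_add_floor] at h1
    rw [← intervalIntegral.integral_add_adjacent_intervals (hGint 0 (Int.fract x)) (hGint _ x), h1,
      add_zero, hunit _ ⟨Int.fract_nonneg x, (Int.fract_lt_one x).le⟩]
    have := hfper.sub_zsmul_eq (x := x) ⌊x⌋
    rw [zsmul_one] at this
    rw [Int.fract, this]
  refine ⟨G, hGi, ?_, fun x y => ?_⟩
  · have := UnitAddCircle.intervalIntegral_preimage 0 G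
    rw [zero_add, hzero] at this
    exact this.symm
  · rw [← intervalIntegral.integral_interval_sub_left (hGint 0 y) (hGint 0 x), hfrom, hfrom]
    push_cast; ring

/-- Bound for the integrals of `G` over the first `n` rotated copies of an arc, when `G` is `L¹`-close
to `c` plus the coboundary of `ψ`. -/
theorem norm_sum_integral_le {α : ℝ} {G : UnitAddCircle → ℂ} (hG : Integrable G)
    (hG0 : ∫ t, G t = 0) {c : ℂ} {p ψ : C(UnitAddCircle, ℂ)}
    (hp : ∀ t, p t = c + (ψ (t + (α : UnitAddCircle)) - ψ t)) {η : ℝ}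
    (hη : ∫ t, ‖G t - p t‖ ≤ η) {n K : ℕ} {δ L x : ℝ} (hδ : 0 < δ)
    (hL0 : 0 ≤ L) (hL1 : L ≤ 1) (hLK : L ≤ K * δ)
    (hα : ∀ i < n, ∀ j < n, i ≠ j → ∀ m : ℤ, δ ≤ |(x + i * α) - (x + j * α) - m|) :
    ‖∑ i ∈ Finset.range n, ∫ t in (x + i * α)..(x + i * α) + L, G t‖
      ≤ K * η + (n * η + 2 * ‖ψ‖) * L := by
  have hci : ∀ φ : C(UnitAddCircle, ℂ), Integrable φ := fun φ =>
    φ.continuous.integrable_of_hasCompactSupport (HasCompactSupport.of_compactSpace _)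
  have hper : ∀ F : UnitAddCircle → ℂ, Function.Periodic (fun t : ℝ => F t) 1 := fun F t => by
    simp only [AddCircle.coe_add_period]
  have hint : ∀ F : UnitAddCircle → ℂ, Integrable F → ∀ x y : ℝ,
      IntervalIntegrable (fun t : ℝ => F t) volume x y := fun F hF => by
    refine (hper F).intervalIntegrable (t := 0) one_ne_zero ?_
    rw [intervalIntegrable_iff_integrableOn_Ioc_of_le (by norm_num)]
    exact (UnitAddCircle.measurePreserving_mk 0).integrable_comp_of_integrable hF
  have hc : ‖c‖ ≤ η := by
    have h1 : ∫ t, p t = c := by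
      have hψ : Integrable fun t => ψ (t + (α : UnitAddCircle)) := (hci ψ).comp_add_right _
      have hψ' : Integrable fun t => ψ (t + (α : UnitAddCircle)) - ψ t := hψ.sub (hci ψ)
      simp_rw [hp]
      rw [integral_add (integrable_const _) hψ', integral_sub hψ (hci ψ),
        integral_add_right_eq_self]
      simp [Measure.real]
    have h2 : ∫ t, (G t - p t) = -c := by
      rw [integral_sub hG (hci p), hG0, h1, zero_sub]
    rw [← norm_neg, ← h2]
    exact (norm_integral_le_integral_norm _).trans hη
  have hsplit : ∑ i ∈ Finset.range n, ∫ t in (x + i * α)..(x + i * α) + L, G t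
      = (∑ i ∈ Finset.range n, ∫ t in (x + i * α)..(x + i * α) + L, (G t - p t))
        + ∑ i ∈ Finset.range n, ∫ t in (x + i * α)..(x + i * α) + L, p t := by
    rw [← Finset.sum_add_distrib]
    refine Finset.sum_congr rfl fun i _ => ?_
    rw [intervalIntegral.integral_sub (hint G hG _ _) (hint p (hci p) _ _), sub_add_cancel]
  have herr : ‖∑ i ∈ Finset.range n, ∫ t in (x + i * α)..(x + i * α) + L, (G t - p t)‖
      ≤ K * η := by
    have h1 := sum_integral_le_of_separated (w := fun t : ℝ => ‖G t - p t‖)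
      (fun t => by simp only [AddCircle.coe_add_period]) (fun t => norm_nonneg _)
      (fun y z => (hint (fun t => G t - p t) (hG.sub (hci p)) y z).norm) hδ hL0 hL1 hLK hα
    have h2 := UnitAddCircle.intervalIntegral_preimage 0 (fun t => ‖G t - p t‖)
    rw [zero_add] at h2
    rw [h2] at h1
    calc _ ≤ ∑ i ∈ Finset.range n, ∫ t in (x + i * α)..(x + i * α) + L, ‖G t - p t‖ :=
          (norm_sum_le _ _).trans (Finset.sum_le_sum fun i _ =>
            intervalIntegral.norm_integral_le_integral_norm (by linarith))
      _ ≤ _ := h1.trans (by gcongr)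
  have htel : ∀ t : ℝ, ∑ i ∈ Finset.range n, p ((t + i * α : ℝ) : UnitAddCircle)
      = n * c + (ψ ((t + n * α : ℝ) : UnitAddCircle) - ψ t) := by
    intro t
    have h1 : ∀ i : ℕ, p ((t + i * α : ℝ) : UnitAddCircle)
        = c + (ψ ((t + (i + 1 : ℕ) * α : ℝ) : UnitAddCircle)
          - ψ ((t + i * α : ℝ) : UnitAddCircle)) := by
      intro i
      rw [hp, ← AddCircle.coe_add, add_assoc t, Nat.cast_succ, add_one_mul]
    simp_rw [h1]
    rw [Finset.sum_add_distrib,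
      Finset.sum_range_sub (fun i : ℕ => ψ ((t + i * α : ℝ) : UnitAddCircle))]
    simp
  have hmain : ‖∑ i ∈ Finset.range n, ∫ t in (x + i * α)..(x + i * α) + L, p t‖
      ≤ (n * η + 2 * ‖ψ‖) * L := by
    have h1 : ∑ i ∈ Finset.range n, ∫ t in (x + i * α)..(x + i * α) + L, p t
        = ∫ t in x..x + L, (n * c + (ψ ((t + n * α : ℝ) : UnitAddCircle) - ψ t)) := by
      simp_rw [← htel]
      rw [intervalIntegral.integral_finsetSum]
      · refine Finset.sum_congr rfl fun i _ => ?_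
        rw [intervalIntegral.integral_comp_add_right (fun t : ℝ => p (t : UnitAddCircle))]
        congr 1
        ring
      · intro i _
        have hcont : Continuous fun t : ℝ => ((t + i * α : ℝ) : UnitAddCircle) :=
          (AddCircle.continuous_mk' 1).comp (continuous_add_const (i * α))
        exact (p.continuous.comp hcont).intervalIntegrable _ _
    rw [h1]
    have h2 := intervalIntegral.norm_integral_le_of_norm_le_const (a := x) (b := x + L)
      (f := fun t : ℝ => (n * c + (ψ ((t + n * α : ℝ) : UnitAddCircle) - ψ t)))
      (C := n * η + 2 * ‖ψ‖) (fun t _ => by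
        refine (norm_add_le _ _).trans (add_le_add ?_ ?_)
        · rw [norm_mul, Complex.norm_natCast]; gcongr
        · refine (norm_sub_le _ _).trans ?_
          rw [two_mul]
          exact add_le_add (ψ.norm_coe_le_norm _) (ψ.norm_coe_le_norm _))
    rwa [add_sub_cancel_left, abs_of_nonneg hL0] at h2
  rw [hsplit]
  exact (norm_add_le _ _).trans (add_le_add herr hmain)

/-- For an irrational rotation by `α` with denominators `(q_s)` with bounded partial quotients (`aₙ < C`) and an absolutely
continuous `f : 𝕋 → ℝ` (modelled as a `1`-periodic function on `ℝ`),
`sup_{0 ≤ n ≤ q_{s+1}} sup_{‖y-x‖ < 1/q_s} |f^{(n)}(y) - f^{(n)}(x)| → 0` as `s → ∞`. -/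
theorem stmt_9 (α : ℝ) (hα : Irrational α) (a q : ℕ → ℕ) (P : ℕ → ℤ)
    (C : ℕ) (hC : 2 ≤ C) (ha : ∀ n, 1 ≤ n → 1 ≤ a n) (haC : ∀ n, a n < C)
    (hq0 : q 0 = 1) (hq1 : q 1 = a 1)
    (hqrec : ∀ n, 1 ≤ n → q (n + 1) = a (n + 1) * q n + q (n - 1))
    (happrox : ∀ n, 1 ≤ n →
      1 / (2 * (q n : ℝ) * q (n + 1)) < |α - (P n : ℝ) / q n| ∧
        |α - (P n : ℝ) / q n| < 1 / ((q n : ℝ) * q (n + 1)))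
    (hround : ∀ n, 1 ≤ n → round ((q n : ℝ) * α) = P n)
    (f : ℝ → ℝ) (hper : ∀ x, f (x + 1) = f x)
    (hac : AbsolutelyContinuousOn f 0 1) :
    ∀ ε : ℝ, 0 < ε → ∃ s₀ : ℕ, ∀ s, s₀ ≤ s →
      ∀ n ≤ q (s + 1), ∀ x y : ℝ, |y - x - round (y - x)| < 1 / (q s : ℝ) →
        |(∑ i ∈ Finset.range n, f (y + i * α)) - ∑ i ∈ Finset.range n, f (x + i * α)| < ε := by
  obtain ⟨g, hg, hfg⟩ := hac
  obtain ⟨G, hG, hG0, hGf⟩ := exists_integrable_increment_eq_integral hper hg hfg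
  have hb := denominators_bounds ha haC hq0 hq1 hqrec
  have hCpos : (0 : ℝ) < C := by positivity
  intro ε hε
  set K : ℕ := 8 * C ^ 4 with hK
  set η : ℝ := ε / (2 * (K + C)) with hη
  have hηpos : 0 < η := by positivity
  obtain ⟨c, p, ψ, hp, hGp⟩ := exists_coboundary_near hα hG hηpos
  obtain ⟨N, hN⟩ := exists_nat_gt (4 * ‖ψ‖ / ε)
  refine ⟨N + 1, fun s hs n hn => ?_⟩
  have hqpos : (0 : ℝ) < q s := by exact_mod_cast (hb s).2.1
  have hqs : (N : ℝ) ≤ q s := by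
    obtain ⟨s, rfl⟩ := Nat.exists_eq_add_of_le' (show 1 ≤ s by omega)
    exact_mod_cast (show N ≤ s + 1 by omega).trans (hb s).1
  have hnq : (n : ℝ) ≤ C * q s := by exact_mod_cast hn.trans (hb s).2.2.2
  have hsep : ∀ i < n, ∀ j < i, ∀ m : ℤ, 1 / (K * q s : ℝ) ≤ |((i : ℝ) - j) * α - m| := by
    intro i hi j hj m
    have h1 := abs_mul_sub_ge_of_bounded ha haC hq0 hq1 hqrec happrox
      (k := (i : ℤ) - j) (by omega) m
    push_cast at h1
    have hji : (j : ℝ) < i := by exact_mod_cast hj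
    have hin : (i : ℝ) < n := by exact_mod_cast hi
    have hij : (0 : ℝ) < (i : ℝ) - j := by linarith
    have hj0 : (0 : ℝ) ≤ j := by positivity
    refine le_trans ?_ h1
    rw [hK]
    push_cast
    rw [show 8 * (C : ℝ) ^ 4 * q s = 8 * C ^ 3 * (C * q s) by ring]
    gcongr
    linarith
  have hsep' : ∀ x : ℝ, ∀ i < n, ∀ j < n, i ≠ j → ∀ m : ℤ,
      1 / (K * q s : ℝ) ≤ |(x + i * α) - (x + j * α) - m| := by
    intro x i hi j hj hij m
    rcases lt_or_gt_of_ne hij with h | h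
    · rw [← abs_neg]
      convert hsep j hj i h (-m) using 2
      push_cast; ring
    · convert hsep i hi j h m using 2
      ring
  have hforward : ∀ x L : ℝ, 0 ≤ L → L < 1 / (q s : ℝ) →
      |(∑ i ∈ Finset.range n, f (x + L + i * α)) - ∑ i ∈ Finset.range n, f (x + i * α)| < ε := by
    intro x L hL0 hL
    have hK0 : (0 : ℝ) < K := by positivity
    have hq1' : 1 / (q s : ℝ) ≤ 1 := by
      rw [div_le_one hqpos]; exact_mod_cast (hb s).2.1
    have h1 := norm_sum_integral_le (x := x) hG hG0 hp hGp (by positivity) hL0 (hL.le.trans hq1')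
      (by rw [show (K : ℝ) * (1 / (K * q s)) = 1 / q s by field_simp]; exact hL.le) (hsep' x)
    have h2 : ∑ i ∈ Finset.range n, ∫ t in (x + i * α)..(x + i * α) + L, G t
        = (((∑ i ∈ Finset.range n, f (x + L + i * α))
          - ∑ i ∈ Finset.range n, f (x + i * α) : ℝ) : ℂ) := by
      rw [← Finset.sum_sub_distrib, Complex.ofReal_sum]
      refine Finset.sum_congr rfl fun i _ => ?_
      rw [← hGf, add_right_comm]
    rw [h2, Complex.norm_real, Real.norm_eq_abs] at h1
    refine h1.trans_lt ?_
    have h3 : n * L ≤ C := by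
      calc n * L ≤ (C * q s) * (1 / q s) := by gcongr
        _ = C := by field_simp
    have h4 : 2 * ‖ψ‖ * L < ε / 2 := by
      rw [div_lt_iff₀ hε] at hN
      have : 2 * ‖ψ‖ * L ≤ 2 * ‖ψ‖ * (1 / q s) := by gcongr
      refine this.trans_lt ?_
      rw [mul_one_div, div_lt_iff₀ hqpos]
      nlinarith
    have h5 : (K + C) * η = ε / 2 := by rw [hη]; field_simp
    nlinarith
  intro x y hxy
  set m := round (y - x)
  have hfper : Function.Periodic f 1 := hper
  have hshift : ∀ i : ℕ, f (y + i * α) = f (y - m + i * α) := fun i => by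
    have := hfper.sub_zsmul_eq (x := y + i * α) m
    rw [zsmul_one] at this
    rw [← this]; ring_nf
  simp_rw [hshift]
  rcases le_total x (y - m) with h | h
  · have := hforward x (y - m - x) (by linarith) (by linarith [le_abs_self (y - x - m)])
    rwa [add_sub_cancel] at this
  · have := hforward (y - m) (x - (y - m)) (by linarith) (by linarith [neg_abs_le (y - x - m)])
    rwa [add_sub_cancel, abs_sub_comm] at this
end

section
/- Let T : 𝕋 → 𝕋 be an ergodic irrational rotation and f : 𝕋 → ℝ a positive piecewise absolutely continuous function, bounded away from zero, with non-zero sum of jumps S(f) = ∑_j (f_−(β_j) − f_+(β_j)) ≠ 0. Then the special flow T^f is not partially rigid along any sequence t_n → +∞. -/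
open MeasureTheory Filter

theorem volume_inter_near_le {h : ℕ → ℝ → ℝ} {s : Set ℝ} {c ε t V W L : ℝ} {J : ℕ}
    (hc : 0 < c) (hL : 0 < L) (hε : 0 < ε) (hV : 0 ≤ V) (hW : 0 ≤ W)
    (hstep : ∀ (i j : ℕ) (x : ℝ), i ≤ j → c * ((j : ℝ) - i) ≤ h j x - h i x)
    (hJ : ∀ j x, |h j x - t| < ε → j < J)
    (hosc : ∀ j < J, ∀ x ∈ s, ∀ y ∈ s, |h j y - h j x| ≤ V)
    (hexp : ∀ j x y, x ∈ s → y ∈ s → |h j x - t| < ε →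
      L * |y - x| - W ≤ |h j y - h j x|) :
    volume (s ∩ {x | ∃ j, |h j x - t| < ε}) ≤
      ENNReal.ofReal (((2 * ε + V) / c + 1) * ((2 * ε + W) / L)) := by
  classical
  set act : Finset ℕ := (Finset.range J).filter fun j => ∃ x ∈ s, |h j x - t| < ε with hact
  have hsub : s ∩ {x | ∃ j, |h j x - t| < ε} ⊆
      ⋃ j ∈ act, {x | x ∈ s ∧ |h j x - t| < ε} := by
    rintro x ⟨hx, j, hj⟩
    simp only [Set.mem_iUnion, hact, Finset.mem_filter, Finset.mem_range]
    exact ⟨j, ⟨hJ j x hj, x, hx, hj⟩, hx, hj⟩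
  have hpiece : ∀ j ∈ act, volume {x | x ∈ s ∧ |h j x - t| < ε} ≤
      ENNReal.ofReal ((2 * ε + W) / L) := by
    intro j _
    refine (Real.volume_le_diam _).trans (Metric.ediam_le ?_)
    rintro x ⟨hx, hxt⟩ y ⟨hy, hyt⟩
    rw [edist_dist]
    apply ENNReal.ofReal_le_ofReal
    rw [dist_comm, Real.dist_eq, le_div_iff₀ hL]
    have h1 := hexp j x y hx hy hxt
    have h2 : |h j y - h j x| ≤ 2 * ε := by
      rw [abs_lt] at hxt hyt
      rw [abs_le]; constructor <;> linarith
    linarith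
  have hcard : (act.card : ℝ) ≤ (2 * ε + V) / c + 1 := by
    rcases act.eq_empty_or_nonempty with he | hne
    · rw [he]; simp; positivity
    · have hmin := act.min'_mem hne
      have hmax := act.max'_mem hne
      have hle : act.min' hne ≤ act.max' hne := act.min'_le _ hmax
      set a := act.min' hne
      set b := act.max' hne
      have h1 : act ⊆ Finset.Icc a b := fun j hj =>
        Finset.mem_Icc.2 ⟨act.min'_le _ hj, act.le_max' _ hj⟩
      have h2 := Finset.card_le_card h1
      rw [Nat.card_Icc] at h2
      have h3 : (act.card : ℝ) ≤ b - a + 1 := by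
        have : act.card + a ≤ b + 1 := by omega
        have : (act.card : ℝ) + a ≤ b + 1 := by exact_mod_cast this
        linarith
      simp only [hact, Finset.mem_filter, Finset.mem_range] at hmin hmax
      obtain ⟨haJ, x, hx, hxt⟩ := hmin
      obtain ⟨hbJ, y, hy, hyt⟩ := hmax
      have h4 := hstep a b y hle
      have h5 := hosc a haJ x hx y hy
      rw [abs_lt] at hxt hyt
      rw [abs_le] at h5
      have h6 : (b : ℝ) - a ≤ (2 * ε + V) / c := by
        rw [le_div_iff₀ hc]; linarith
      linarith
  calc volume (s ∩ {x | ∃ j, |h j x - t| < ε})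
      ≤ ∑ j ∈ act, volume {x | x ∈ s ∧ |h j x - t| < ε} :=
        (measure_mono hsub).trans (measure_biUnion_finset_le _ _)
    _ ≤ ∑ _j ∈ act, ENNReal.ofReal ((2 * ε + W) / L) := Finset.sum_le_sum hpiece
    _ = ENNReal.ofReal (act.card * ((2 * ε + W) / L)) := by
        rw [Finset.sum_const, nsmul_eq_mul, ENNReal.ofReal_mul (by positivity),
          ENNReal.ofReal_natCast]
    _ ≤ _ := by
        apply ENNReal.ofReal_le_ofReal
        gcongr

/-- The points of `[p, 1)` not separated from `p` by a point of `P`. -/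
def cell (P : Finset ℝ) (p : ℝ) : Set ℝ := {x | x < 1 ∧ p ≤ x ∧ ∀ q ∈ P, q ∉ Set.Ioc p x}

theorem cell_ordConnected (P : Finset ℝ) (p : ℝ) : (cell P p).OrdConnected := by
  refine ⟨fun x hx y hy z hz => ⟨hz.2.trans_lt hy.1, hx.2.1.trans hz.1, fun q hq hqz => ?_⟩⟩
  exact hy.2.2 q hq ⟨hqz.1, hqz.2.trans hz.2⟩

theorem notMem_Ioc_of_mem_cell {P : Finset ℝ} {p x y q : ℝ} (hx : x ∈ cell P p)
    (hy : y ∈ cell P p) (hq : q ∈ P) : q ∉ Set.Ioc x y := fun h =>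
  hy.2.2 q hq ⟨hx.2.1.trans_lt h.1, h.2⟩

theorem cell_pairwiseDisjoint (P : Finset ℝ) :
    (P : Set ℝ).PairwiseDisjoint (cell P) := by
  intro p hp q hq hpq
  refine Set.disjoint_left.2 fun x hx hy => ?_
  rcases lt_or_gt_of_ne hpq with h | h
  · exact hx.2.2 q hq ⟨h, hy.2.1⟩
  · exact hy.2.2 p hp ⟨h, hx.2.1⟩

theorem biUnion_cell {P : Finset ℝ} (h0 : (0 : ℝ) ∈ P) (hP : ∀ p ∈ P, 0 ≤ p) :
    ⋃ p ∈ P, cell P p = Set.Ico 0 1 := by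
  ext x
  simp only [Set.mem_iUnion, exists_prop]
  constructor
  · rintro ⟨p, hp, hx⟩
    exact ⟨(hP p hp).trans hx.2.1, hx.1⟩
  · rintro ⟨hx0, hx1⟩
    have hne : (P.filter (· ≤ x)).Nonempty := ⟨0, by simp [h0, hx0]⟩
    have hm := Finset.max'_mem _ hne
    rw [Finset.mem_filter] at hm
    refine ⟨_, hm.1, hx1, hm.2, fun q hq hqx => ?_⟩
    exact absurd (Finset.le_max' _ q (by simp [hq, hqx.2])) (not_le.2 hqx.1)

theorem integrableOn_shift {G : ℝ → ℝ} (hper : Function.Periodic G 1)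
    (hint : IntervalIntegrable G volume 0 1) (a : ℝ) :
    IntegrableOn (fun x => G (x + a)) (Set.Ico 0 1) := by
  rw [← intervalIntegrable_iff_integrableOn_Ico_of_le zero_le_one]
  have := (hper.intervalIntegrable₀ one_ne_zero hint (0 + a) (1 + a)).comp_add_right a
  simpa using this

theorem integral_shift {G : ℝ → ℝ} (hper : Function.Periodic G 1) (a : ℝ) :
    ∫ x in Set.Ico 0 1, G (x + a) = ∫ x in (0 : ℝ)..1, G x := by
  rw [integral_Ico_eq_integral_Ioc, ← intervalIntegral.integral_of_le zero_le_one,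
    intervalIntegral.integral_comp_add_right]
  have := hper.intervalIntegral_add_eq (0 + a) 0
  rw [zero_add] at this ⊢
  rw [add_comm 1 a, this, zero_add]

theorem sum_integral_cell {P : Finset ℝ} (h0 : (0 : ℝ) ∈ P) (hP : ∀ p ∈ P, 0 ≤ p)
    {G : ℝ → ℝ} (hper : Function.Periodic G 1) (hint : IntervalIntegrable G volume 0 1)
    (α : ℝ) (J : ℕ) :
    ∑ p ∈ P, ∫ x in cell P p, ∑ i ∈ Finset.range J, G (x + i * α) =
      J * ∫ x in (0 : ℝ)..1, G x := by
  rw [← integral_biUnion_finset P (fun p _ => (cell_ordConnected P p).measurableSet)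
    (cell_pairwiseDisjoint P), biUnion_cell h0 hP, integral_finsetSum]
  · simp [integral_shift hper]
  · exact fun i _ => integrableOn_shift hper hint _
  · intro p hp
    refine IntegrableOn.mono_set (integrable_finsetSum _ fun i _ =>
      integrableOn_shift hper hint _) ?_
    rw [← biUnion_cell h0 hP]
    exact Set.subset_biUnion_of_mem (u := cell P) hp

theorem abs_integral_sum_le_integral_cell {P : Finset ℝ} {p x y : ℝ} (hp : 0 ≤ p)
    {G : ℝ → ℝ} (hper : Function.Periodic G 1) (hint : IntervalIntegrable G volume 0 1)
    {α : ℝ} {j J : ℕ} (hj : j ≤ J) (hx : x ∈ cell P p) (hy : y ∈ cell P p) :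
    |∫ u in x..y, ∑ i ∈ Finset.range j, G (u + i * α)| ≤
      ∫ u in cell P p, ∑ i ∈ Finset.range J, |G (u + i * α)| := by
  have hsub : cell P p ⊆ Set.Ico 0 1 := fun z hz => ⟨hp.trans hz.2.1, hz.1⟩
  have hintJ : IntegrableOn (fun u => ∑ i ∈ Finset.range J, |G (u + i * α)|) (cell P p) :=
    IntegrableOn.mono_set (integrable_finsetSum _ fun i _ =>
      (integrableOn_shift hper hint _).abs) hsub
  have hxy : Set.uIoc x y ⊆ cell P p :=
    Set.uIoc_subset_uIcc.trans ((cell_ordConnected P p).uIcc_subset hx hy)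
  calc |∫ u in x..y, ∑ i ∈ Finset.range j, G (u + i * α)|
      = |∫ u in Set.uIoc x y, ∑ i ∈ Finset.range j, G (u + i * α)| :=
        intervalIntegral.abs_integral_eq_abs_integral_uIoc _
    _ ≤ ∫ u in Set.uIoc x y, |∑ i ∈ Finset.range j, G (u + i * α)| := abs_integral_le_integral_abs
    _ ≤ ∫ u in Set.uIoc x y, ∑ i ∈ Finset.range J, |G (u + i * α)| := by
        refine integral_mono_of_nonneg (ae_of_all _ fun u => abs_nonneg _)
          (hintJ.mono_set hxy) (ae_of_all _ fun u => ?_)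
        refine (Finset.abs_sum_le_sum_abs _ _).trans
          (Finset.sum_le_sum_of_subset_of_nonneg (Finset.range_mono hj) ?_)
        exact fun _ _ _ => abs_nonneg _
    _ ≤ _ := by
        refine setIntegral_mono_set hintJ (ae_of_all _ fun u => ?_) hxy.eventuallyLE
        exact Finset.sum_nonneg fun _ _ => abs_nonneg _

theorem fourier_coe_ne_one {α : ℝ} (hα : Irrational α) {n : ℤ} (hn : n ≠ 0) :
    fourier n (α : AddCircle (1 : ℝ)) ≠ 1 := by
  rw [fourier_coe_apply]
  intro h
  rw [Complex.exp_eq_one_iff] at h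
  obtain ⟨m, hm⟩ := h
  have h1 : (n : ℂ) * α = m := by
    have h2 : (2 * Real.pi * Complex.I : ℂ) ≠ 0 := Complex.two_pi_I_ne_zero
    apply mul_left_cancel₀ h2
    rw [mul_comm _ (m : ℂ), ← hm]
    push_cast; ring
  have h2 : (n : ℝ) * α = m := by exact_mod_cast h1
  exact (hα.intCast_mul hn).ne_int m h2

/-- Every trigonometric polynomial is a constant plus a coboundary of an irrational rotation. -/
theorem exists_eq_const_add_coboundary {α : ℝ} (hα : Irrational α) {p : C(AddCircle (1 : ℝ), ℂ)}
    (hp : p ∈ Submodule.span ℂ (Set.range (fourier (T := (1 : ℝ))))) :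
    ∃ (c : ℂ) (ψ : C(AddCircle (1 : ℝ), ℂ)), ∀ x, p x = c + (ψ (x + α) - ψ x) := by
  induction hp using Submodule.span_induction with
  | mem p hp =>
    obtain ⟨n, rfl⟩ := hp
    rcases eq_or_ne n 0 with rfl | hn
    · exact ⟨1, 0, fun x => by simp⟩
    · refine ⟨0, (fourier n (α : AddCircle (1 : ℝ)) - 1)⁻¹ • fourier n, fun x => ?_⟩
      have h := sub_ne_zero.2 (fourier_coe_ne_one hα hn)
      have h2 : fourier n (x + (α : AddCircle (1 : ℝ))) =
          fourier n x * fourier n (α : AddCircle (1 : ℝ)) := by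
        simp only [fourier_apply, smul_add, AddCircle.toCircle_add, Circle.coe_mul]
      simp only [ContinuousMap.smul_apply, smul_eq_mul, h2]
      field_simp
      ring
  | zero => exact ⟨0, 0, fun x => by simp⟩
  | add p q _ _ hp hq =>
    obtain ⟨c, ψ, h⟩ := hp
    obtain ⟨c', ψ', h'⟩ := hq
    exact ⟨c + c', ψ + ψ', fun x => by simp [h, h']; ring⟩
  | smul a p _ hp =>
    obtain ⟨c, ψ, h⟩ := hp
    exact ⟨a * c, a • ψ, fun x => by simp [h]; ring⟩

theorem exists_trigonometric_integral_sub_lt {g : ℝ → ℝ}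
    (hint : IntervalIntegrable g volume 0 1) {η : ℝ} (hη : 0 < η) :
    ∃ p ∈ Submodule.span ℂ (Set.range (fourier (T := (1 : ℝ)))),
      ∫ x in (0 : ℝ)..1, ‖(g x : ℂ) - p (x : AddCircle (1 : ℝ))‖ < η := by
  have : Fact ((0 : ℝ) < 1) := ⟨one_pos⟩
  set G : AddCircle (1 : ℝ) → ℂ := AddCircle.liftIoc 1 0 fun x => (g x : ℂ) with hG
  have hGm : MemLp G 1 (AddCircle.haarAddCircle) := by
    rw [memLp_haarAddCircle_iff]
    apply MemLp.memLp_liftIoc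
    rw [memLp_one_iff_integrable]
    simp only [zero_add]
    exact ((intervalIntegrable_iff_integrableOn_Ioc_of_le zero_le_one).1 hint).ofReal
  have hmem : hGm.toLp G ∈ closure
      (Submodule.span ℂ (Set.range (@fourierLp (1 : ℝ) _ 1 _)) : Set (Lp ℂ 1 _)) := by
    rw [← Submodule.topologicalClosure_coe, span_fourierLp_closure_eq_top ENNReal.one_ne_top]
    trivial
  obtain ⟨q, hq, hdist⟩ := Metric.mem_closure_iff.1 hmem η hη
  have himg : ∃ p ∈ Submodule.span ℂ (Set.range (fourier (T := (1 : ℝ)))),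
      ContinuousMap.toLp 1 AddCircle.haarAddCircle ℂ p = q := by
    have : Set.range (@fourierLp (1 : ℝ) _ 1 _) =
      (ContinuousMap.toLp (E := ℂ) 1 (AddCircle.haarAddCircle (T := (1 : ℝ))) ℂ).toLinearMap ''
        Set.range (fourier (T := (1 : ℝ))) := by
      rw [← Set.range_comp]; rfl
    rw [this, Submodule.span_image] at hq
    exact hq
  obtain ⟨p, hp, rfl⟩ := himg
  refine ⟨p, hp, ?_⟩
  rw [dist_eq_norm, L1.norm_eq_integral_norm] at hdist
  have h1 : ∫ x, ‖(hGm.toLp G - ContinuousMap.toLp 1 AddCircle.haarAddCircle ℂ p :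
        Lp ℂ 1 AddCircle.haarAddCircle) x‖ ∂AddCircle.haarAddCircle =
      ∫ x, ‖G x - p x‖ ∂AddCircle.haarAddCircle := by
    refine integral_congr_ae ?_
    filter_upwards [Lp.coeFn_sub (hGm.toLp G) (ContinuousMap.toLp 1 AddCircle.haarAddCircle ℂ p),
      hGm.coeFn_toLp, ContinuousMap.coeFn_toLp (p := 1) (𝕜 := ℂ) AddCircle.haarAddCircle p]
      with x hx1 hx2 hx3
    rw [hx1, Pi.sub_apply, hx2, hx3]
  rw [h1, AddCircle.integral_haarAddCircle, ← AddCircle.intervalIntegral_preimage 1 0] at hdist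
  simp only [zero_add, inv_one, one_smul] at hdist
  refine lt_of_eq_of_lt ?_ hdist
  rw [intervalIntegral.integral_of_le zero_le_one, intervalIntegral.integral_of_le zero_le_one]
  refine setIntegral_congr_fun measurableSet_Ioc fun x hx => ?_
  simp only [hG]
  rw [AddCircle.liftIoc_coe_apply (by simpa using hx)]

/-- In mean, a periodic integrable function is a constant plus a bounded coboundary. -/
theorem exists_coboundary_integral_abs_sub_le {α : ℝ} (hα : Irrational α) {g : ℝ → ℝ}
    (hint : IntervalIntegrable g volume 0 1) {η : ℝ} (hη : 0 < η) :
    ∃ (φ : ℝ → ℝ) (M : ℝ), Continuous φ ∧ Function.Periodic φ 1 ∧ (∀ x, |φ x| ≤ M) ∧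
      ∫ x in (0 : ℝ)..1, |g x - ((∫ u in (0 : ℝ)..1, g u) + (φ (x + α) - φ x))| ≤ η := by
  have : Fact ((0 : ℝ) < 1) := ⟨one_pos⟩
  obtain ⟨p, hp, hlt⟩ := exists_trigonometric_integral_sub_lt hint (half_pos hη)
  obtain ⟨c, ψ, hψ⟩ := exists_eq_const_add_coboundary hα hp
  set φ : ℝ → ℝ := fun x => (ψ (x : AddCircle (1 : ℝ))).re with hφ
  have hcont : Continuous φ := by
    have : Continuous fun x : ℝ => (x : AddCircle (1 : ℝ)) := AddCircle.continuous_mk' 1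
    fun_prop
  have hper : Function.Periodic φ 1 := fun x => by
    simp only [hφ]
    rw [AddCircle.coe_add_period]
  set S := ∫ u in (0 : ℝ)..1, g u with hS
  set e : ℝ → ℝ := fun x => g x - (c.re + (φ (x + α) - φ x)) with he
  have hei : IntervalIntegrable e volume 0 1 :=
    hint.sub (Continuous.intervalIntegrable (by fun_prop) _ _)
  have hre : ∫ x in (0 : ℝ)..1, |e x| ≤ η / 2 := by
    refine le_trans (intervalIntegral.integral_mono_on zero_le_one hei.abs ?_ fun x _ => ?_) hlt.le
    · have hc : Continuous fun x : ℝ => p (x : AddCircle (1 : ℝ)) :=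
        p.continuous.comp (AddCircle.continuous_mk' 1)
      have hg : IntervalIntegrable (fun x => (g x : ℂ)) volume 0 1 :=
        ⟨Integrable.ofReal hint.1, Integrable.ofReal hint.2⟩
      exact (hg.sub (hc.intervalIntegrable _ _)).norm
    · refine le_trans (le_of_eq ?_) (Complex.abs_re_le_norm _)
      rw [hψ]
      simp [he, hφ]
  have hcob : ∫ x in (0 : ℝ)..1, (φ (x + α) - φ x) = 0 := by
    rw [intervalIntegral.integral_sub (Continuous.intervalIntegrable (by fun_prop) _ _)
      (hcont.intervalIntegrable _ _), intervalIntegral.integral_comp_add_right]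
    have := hper.intervalIntegral_add_eq (0 + α) 0
    rw [zero_add] at this ⊢
    rw [add_comm 1 α, this, zero_add, sub_self]
  have hSc : ∫ x in (0 : ℝ)..1, e x = S - c.re := by
    have h1 : IntervalIntegrable (fun x => φ (x + α) - φ x) volume 0 1 :=
      Continuous.intervalIntegrable (by fun_prop) _ _
    rw [he, intervalIntegral.integral_sub hint (intervalIntegrable_const.add h1),
      intervalIntegral.integral_add intervalIntegrable_const h1, hcob]
    simp [hS]
  have hSc' : |S - c.re| ≤ η / 2 := by
    rw [← hSc]
    exact (intervalIntegral.abs_integral_le_integral_abs zero_le_one).trans hre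
  refine ⟨φ, ‖ψ‖, hcont, hper, fun x =>
    (Complex.abs_re_le_norm _).trans (ψ.norm_coe_le_norm _), ?_⟩
  calc ∫ x in (0 : ℝ)..1, |g x - (S + (φ (x + α) - φ x))|
      ≤ ∫ x in (0 : ℝ)..1, (|e x| + |S - c.re|) := by
        refine intervalIntegral.integral_mono_on zero_le_one ?_
          (hei.abs.add intervalIntegrable_const) fun x _ => ?_
        · exact (hint.sub (Continuous.intervalIntegrable (by fun_prop) _ _)).abs
        · have : g x - (S + (φ (x + α) - φ x)) = e x - (S - c.re) := by simp only [he]; ring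
          rw [this]
          exact abs_sub _ _
    _ = (∫ x in (0 : ℝ)..1, |e x|) + |S - c.re| := by
        rw [intervalIntegral.integral_add hei.abs intervalIntegrable_const]
        simp
    _ ≤ η := by linarith

theorem sum_shift_eq_add_coboundary (g φ : ℝ → ℝ) (S α u : ℝ) (j : ℕ) :
    ∑ i ∈ Finset.range j, g (u + i * α) = j * S + (φ (u + j * α) - φ u) +
      ∑ i ∈ Finset.range j,
        (g (u + i * α) - (S + (φ (u + i * α + α) - φ (u + i * α)))) := by
  induction j with
  | zero => simp
  | succ j ih =>
    rw [Finset.sum_range_succ, Finset.sum_range_succ, ih]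
    have : u + ((j + 1 : ℕ) : ℝ) * α = u + j * α + α := by push_cast; ring
    rw [this]
    push_cast
    ring

theorem card_mul_le_integral_sum_shift_add {g φ : ℝ → ℝ} {S α M p x y : ℝ} {P : Finset ℝ}
    {j J : ℕ} (hp : 0 ≤ p) (hφ : Continuous φ) (hφper : Function.Periodic φ 1)
    (hM : ∀ x, |φ x| ≤ M) (hper : Function.Periodic g 1)
    (hint : IntervalIntegrable g volume 0 1) (hj : j ≤ J)
    (hx : x ∈ cell P p) (hy : y ∈ cell P p) :
    (j * |S| - 2 * M) * |y - x| - ∫ u in cell P p, ∑ i ∈ Finset.range J,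
        |g (u + i * α) - (S + (φ (u + i * α + α) - φ (u + i * α)))| ≤
      |∫ u in x..y, ∑ i ∈ Finset.range j, g (u + i * α)| := by
  set r : ℝ → ℝ := fun u => g u - (S + (φ (u + α) - φ u)) with hr
  have hrper : Function.Periodic r 1 := fun u => by
    simp only [hr]
    rw [hper, hφper, show u + 1 + α = u + α + 1 by ring, hφper]
  have hrint : IntervalIntegrable r volume 0 1 :=
    hint.sub (Continuous.intervalIntegrable (by fun_prop) _ _)
  have hE := abs_integral_sum_le_integral_cell (α := α) hp hrper hrint hj hx hy
  have hrsum : IntervalIntegrable (fun u => ∑ i ∈ Finset.range j, r (u + i * α)) volume x y := by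
    have := IntervalIntegrable.sum (μ := volume) (a := x) (b := y) (Finset.range j)
      (f := fun (i : ℕ) u => r (u + i * α)) fun i _ => by
        simpa using (hrper.intervalIntegrable₀ one_ne_zero hrint (x + i * α)
          (y + i * α)).comp_add_right (i * α)
    refine this.congr fun u _ => ?_
    simp
  have hφi : IntervalIntegrable (fun u => φ (u + j * α) - φ u) volume x y :=
    Continuous.intervalIntegrable (by fun_prop) _ _
  have hsplit : ∫ u in x..y, ∑ i ∈ Finset.range j, g (u + i * α) =
      j * S * (y - x) + (∫ u in x..y, (φ (u + j * α) - φ u)) +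
        ∫ u in x..y, ∑ i ∈ Finset.range j, r (u + i * α) := by
    simp_rw [sum_shift_eq_add_coboundary g φ S α]
    rw [intervalIntegral.integral_add (intervalIntegrable_const.add hφi) hrsum,
      intervalIntegral.integral_add intervalIntegrable_const hφi]
    rw [intervalIntegral.integral_const, smul_eq_mul]
    ring
  have hE1 : |∫ u in x..y, (φ (u + j * α) - φ u)| ≤ 2 * M * |y - x| := by
    rw [← Real.norm_eq_abs]
    refine intervalIntegral.norm_integral_le_of_norm_le_const fun u _ => ?_
    rw [Real.norm_eq_abs]
    have h1 := hM (u + j * α)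
    have h2 := hM u
    rw [abs_le] at *
    constructor <;> linarith
  have h0 : |(j : ℝ) * S * (y - x)| = j * |S| * |y - x| := by
    rw [abs_mul, abs_mul, Nat.abs_cast]
  rw [hsplit]
  set a := (j : ℝ) * S * (y - x)
  set b := ∫ u in x..y, (φ (u + j * α) - φ u)
  set e := ∫ u in x..y, ∑ i ∈ Finset.range j, r (u + i * α)
  have h3 : |a| ≤ |a + b + e| + |b| + |e| := by
    calc |a| = |(a + b + e) - b - e| := by ring_nf
      _ ≤ |(a + b + e) - b| + |e| := abs_sub _ _
      _ ≤ |a + b + e| + |b| + |e| := by gcongr; exact abs_sub _ _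
  rw [h0] at h3
  linarith

/-- Points of `[0, 1)` cutting it into cells of length at most `1 / J` whose first `J` translates
by `α` avoid `Z` modulo `1`. -/
noncomputable def cutPoints (Z : Finset ℝ) (α : ℝ) (J : ℕ) : Finset ℝ :=
  (Z ×ˢ Finset.range J).image (fun q => Int.fract (q.1 - q.2 * α)) ∪
    (Finset.range J).image fun l : ℕ => (l / J : ℝ)

theorem cutPoints_nonneg {Z : Finset ℝ} {α : ℝ} {J : ℕ} : ∀ p ∈ cutPoints Z α J, 0 ≤ p := by
  intro p hp
  simp only [cutPoints, Finset.mem_union, Finset.mem_image] at hp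
  rcases hp with ⟨q, -, rfl⟩ | ⟨l, -, rfl⟩
  · exact Int.fract_nonneg _
  · positivity

theorem zero_mem_cutPoints {Z : Finset ℝ} {α : ℝ} {J : ℕ} (hJ : 0 < J) :
    (0 : ℝ) ∈ cutPoints Z α J := by
  simp only [cutPoints, Finset.mem_union, Finset.mem_image]
  exact Or.inr ⟨0, by simpa using hJ, by simp⟩

theorem card_cutPoints_le (Z : Finset ℝ) (α : ℝ) (J : ℕ) :
    (cutPoints Z α J).card ≤ (Z.card + 1) * J := by
  refine (Finset.card_union_le _ _).trans ?_
  refine (add_le_add Finset.card_image_le Finset.card_image_le).trans ?_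
  simp [Finset.card_product, add_mul]

theorem volume_cell_cutPoints_le {Z : Finset ℝ} {α p : ℝ} {J : ℕ} (hJ : 0 < J) (hp : 0 ≤ p) :
    volume (cell (cutPoints Z α J) p) ≤ ENNReal.ofReal (1 / J) := by
  refine (Real.volume_le_diam _).trans (Metric.ediam_le ?_)
  have key : ∀ x ∈ cell (cutPoints Z α J) p, ∀ y ∈ cell (cutPoints Z α J) p,
      x ≤ y → y - x ≤ 1 / J := by
    intro x hx y hy _
    have hJ' : (0 : ℝ) < J := by exact_mod_cast hJ
    have hy0 : 0 ≤ y := hp.trans hy.2.1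
    have h1 : ((⌊y * J⌋₊ : ℕ) : ℝ) ≤ y * J := Nat.floor_le (by positivity)
    have h2 : y * J < ⌊y * J⌋₊ + 1 := Nat.lt_floor_add_one _
    have h3 : ⌊y * J⌋₊ < J := by
      have : ((⌊y * J⌋₊ : ℕ) : ℝ) < J := by nlinarith [hy.1]
      exact_mod_cast this
    have h4 : ((⌊y * J⌋₊ : ℕ) / J : ℝ) ∈ cutPoints Z α J := by
      simp only [cutPoints, Finset.mem_union, Finset.mem_image]
      exact Or.inr ⟨⌊y * J⌋₊, by simpa using h3, rfl⟩
    have h5 := notMem_Ioc_of_mem_cell hx hy h4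
    have h6 : ((⌊y * J⌋₊ : ℕ) / J : ℝ) ≤ x := by
      by_contra! hlt
      exact h5 ⟨hlt, by rw [div_le_iff₀ hJ']; exact h1⟩
    rw [div_le_iff₀ hJ'] at h6
    rw [le_div_iff₀ hJ']
    linarith
  intro x hx y hy
  rw [edist_dist]
  apply ENNReal.ofReal_le_ofReal
  rw [Real.dist_eq]
  rcases le_total x y with h | h
  · rw [abs_sub_comm, abs_of_nonneg (by linarith)]; exact key x hx y hy h
  · rw [abs_of_nonneg (by linarith)]; exact key y hy x hx h

theorem sum_sub_sum_eq_integral_of_mem_cell {f g : ℝ → ℝ} {Z : Finset ℝ} {α p x y : ℝ} {j J : ℕ}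
    (hfg : ∀ x y, x ≤ y → (∀ b ∈ Z, ∀ m : ℤ, b + m ∉ Set.Ioc x y) →
      f y - f x = ∫ u in x..y, g u)
    (hper : Function.Periodic g 1) (hint : IntervalIntegrable g volume 0 1)
    (hp : 0 ≤ p) (hj : j ≤ J)
    (hx : x ∈ cell (cutPoints Z α J) p) (hy : y ∈ cell (cutPoints Z α J) p) :
    (∑ i ∈ Finset.range j, f (y + i * α)) - ∑ i ∈ Finset.range j, f (x + i * α) =
      ∫ u in x..y, ∑ i ∈ Finset.range j, g (u + i * α) := by
  wlog hxy : x ≤ y generalizing x y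
  · rw [intervalIntegral.integral_symm, ← this hy hx (le_of_not_ge hxy)]
    ring
  rw [intervalIntegral.integral_finsetSum, ← Finset.sum_sub_distrib]
  · refine Finset.sum_congr rfl fun i hi => ?_
    rw [intervalIntegral.integral_comp_add_right]
    refine hfg _ _ (by linarith) fun b hb m hm => ?_
    have h1 : b + m - i * α ∈ Set.Ioc x y := ⟨by linarith [hm.1], by linarith [hm.2]⟩
    have h2 : Int.fract (b - i * α) = b + m - i * α := by
      rw [Int.fract_eq_iff]
      exact ⟨(hp.trans hx.2.1).trans h1.1.le, h1.2.trans_lt hy.1, -m, by push_cast; ring⟩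
    refine notMem_Ioc_of_mem_cell hx hy ?_ h1
    rw [← h2]
    simp only [cutPoints, Finset.mem_union, Finset.mem_image]
    refine Or.inl ⟨(b, i), ?_, rfl⟩
    simp only [Finset.mem_range] at hi
    simp [hb, hi.trans_le hj]
  · intro i _
    simpa using (hper.intervalIntegrable₀ one_ne_zero hint (x + i * α)
          (y + i * α)).comp_add_right (i * α)

/-- For large `t`, the set of points having a Birkhoff sum `ε`-close to `t` has measure `O(ε)`. -/
theorem exists_eventually_volume_near_le {f g : ℝ → ℝ} {α c B : ℝ} {Z : Finset ℝ}
    (hα : Irrational α) (hc : 0 < c) (hfc : ∀ x, c ≤ f x) (hfB : ∀ x, f x ≤ B)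
    (hper : Function.Periodic g 1) (hint : IntervalIntegrable g volume 0 1)
    (hS : ∫ u in (0 : ℝ)..1, g u ≠ 0)
    (hfg : ∀ x y, x ≤ y → (∀ b ∈ Z, ∀ m : ℤ, b + m ∉ Set.Ioc x y) →
      f y - f x = ∫ u in x..y, g u) :
    ∃ C, 0 < C ∧ ∀ ε, 0 < ε → ε ≤ c → ∀ᶠ t in atTop,
      volume (Set.Ico 0 1 ∩ {x | ∃ j : ℕ, |∑ i ∈ Finset.range j, f (x + i * α) - t| < ε}) ≤
        ENNReal.ofReal (C * ε) := by
  set S := ∫ u in (0 : ℝ)..1, g u with hSdef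
  set N := ∫ u in (0 : ℝ)..1, |g u| with hN
  have hSpos : 0 < |S| := abs_pos.2 hS
  have hN0 : 0 ≤ N := intervalIntegral.integral_nonneg zero_le_one fun _ _ => abs_nonneg _
  have hB : 0 < B := hc.trans_le ((hfc 0).trans (hfB 0))
  set κ := c / (4 * B) with hκ
  have hκ0 : 0 < κ := by positivity
  set K := 6 / (κ * |S|) with hK
  have hK0 : 0 < K := by positivity
  refine ⟨K * (N / c + 3 * (Z.card + 1)) + 1, by positivity, fun ε hε hεc => ?_⟩
  obtain ⟨φ, M, hφ, hφper, hM, hη⟩ :=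
    exists_coboundary_integral_abs_sub_le hα hint (pow_pos hε 2)
  filter_upwards [eventually_ge_atTop (2 * ε), eventually_ge_atTop (ε + c),
    eventually_ge_atTop (4 * M * c / (κ * |S|))] with t ht1 ht2 ht3
  have ht0 : 0 < t := by linarith
  set J := ⌊(t + ε) / c⌋₊ + 1 with hJ
  have hJ0 : 0 < J := Nat.succ_pos _
  have hJr : (0 : ℝ) < J := by exact_mod_cast hJ0
  have hJlow : (t + ε) / c < J := by
    rw [hJ]; push_cast; exact Nat.lt_floor_add_one _
  have hJup : (J : ℝ) ≤ 2 * t / c := by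
    have h1 : ((⌊(t + ε) / c⌋₊ : ℕ) : ℝ) ≤ (t + ε) / c := Nat.floor_le (by positivity)
    rw [hJ]
    push_cast
    have h2 : (t + ε) / c + 1 = (t + ε + c) / c := by field_simp
    calc ((⌊(t + ε) / c⌋₊ : ℕ) : ℝ) + 1 ≤ (t + ε + c) / c := by linarith
      _ ≤ 2 * t / c := by gcongr; linarith
  set h : ℕ → ℝ → ℝ := fun j x => ∑ i ∈ Finset.range j, f (x + i * α) with hh
  set A := {x | ∃ j : ℕ, |h j x - t| < ε} with hA
  set P := cutPoints Z α J with hP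
  set r : ℝ → ℝ := fun u => g u - (S + (φ (u + α) - φ u)) with hr
  have hrper : Function.Periodic r 1 := fun u => by
    simp only [hr]
    rw [hper, hφper, show u + 1 + α = u + α + 1 by ring, hφper]
  have hrint : IntervalIntegrable r volume 0 1 :=
    hint.sub (Continuous.intervalIntegrable (by fun_prop) _ _)
  set V : ℝ → ℝ := fun p => ∫ u in cell P p, ∑ i ∈ Finset.range J, |g (u + i * α)| with hV
  set W : ℝ → ℝ := fun p => ∫ u in cell P p, ∑ i ∈ Finset.range J, |r (u + i * α)| with hW
  have hV0 : ∀ p, 0 ≤ V p := fun p =>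
    integral_nonneg fun u => Finset.sum_nonneg fun _ _ => abs_nonneg _
  have hW0 : ∀ p, 0 ≤ W p := fun p =>
    integral_nonneg fun u => Finset.sum_nonneg fun _ _ => abs_nonneg _
  have hP0 : (0 : ℝ) ∈ P := zero_mem_cutPoints hJ0
  have hPn : ∀ p ∈ P, 0 ≤ p := cutPoints_nonneg
  have hVsum : ∑ p ∈ P, V p = J * N :=
    sum_integral_cell hP0 hPn (hper.comp (fun z : ℝ => |z|)) hint.abs α J
  have hWsum : ∑ p ∈ P, W p ≤ J * ε ^ 2 := by
    rw [show ∑ p ∈ P, W p = J * ∫ u in (0 : ℝ)..1, |r u| from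
      sum_integral_cell hP0 hPn (hrper.comp (fun z : ℝ => |z|)) hrint.abs α J]
    gcongr
  have hstep : ∀ (i j : ℕ) (x : ℝ), i ≤ j → c * ((j : ℝ) - i) ≤ h j x - h i x := by
    intro i j x hij
    simp only [hh]
    rw [← Finset.sum_Ico_eq_sub _ hij]
    have := Finset.card_nsmul_le_sum (Finset.Ico i j) (fun l : ℕ => f (x + l * α)) c
      fun l _ => hfc _
    rw [Nat.card_Ico, nsmul_eq_mul, Nat.cast_sub hij] at this
    linarith
  have hle : ∀ (j : ℕ) (x : ℝ), h j x ≤ j * B := by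
    intro j x
    have := Finset.sum_le_card_nsmul (Finset.range j) (fun l : ℕ => f (x + l * α)) B
      fun l _ => hfB _
    rwa [Finset.card_range, nsmul_eq_mul] at this
  have hlt : ∀ (j : ℕ) (x : ℝ), |h j x - t| < ε → j < J := by
    intro j x hj
    have h1 := hstep 0 j x (Nat.zero_le _)
    have h2 : h 0 x = 0 := by simp [hh]
    rw [abs_lt] at hj
    have h3 : (j : ℝ) < J := by
      refine lt_of_le_of_lt ?_ hJlow
      rw [le_div_iff₀ hc]
      simp only [Nat.cast_zero, sub_zero, h2] at h1
      linarith
    exact_mod_cast h3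
  have hge : ∀ (j : ℕ) (x : ℝ), |h j x - t| < ε → κ * J ≤ j := by
    intro j x hj
    have h1 := hle j x
    rw [abs_lt] at hj
    have h2 : κ * J ≤ t / (2 * B) := by
      calc κ * J ≤ κ * (2 * t / c) := by gcongr
        _ = t / (2 * B) := by rw [hκ]; field_simp; norm_num
    refine h2.trans ?_
    rw [div_le_iff₀ (by positivity)]
    linarith
  set L := κ * J * |S| / 2 with hL
  have hL0 : 0 < L := by positivity
  have hML : 2 * M ≤ L := by
    have h1 : t / c ≤ J := (by gcongr; linarith : t / c ≤ (t + ε) / c).trans hJlow.le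
    have h2 : 4 * M ≤ κ * |S| * (t / c) := by
      rw [div_le_iff₀ (by positivity)] at ht3
      rw [← mul_div_assoc, le_div_iff₀ hc]
      linarith
    have h3 : κ * |S| * (t / c) ≤ κ * |S| * J := by gcongr
    rw [hL]
    linarith
  have hcell : ∀ p ∈ P, volume (cell P p ∩ A) ≤
      ENNReal.ofReal ((V p / c + 3) * (K * ε / J) + W p / (ε * J)) := by
    intro p hp
    rcases le_or_gt (W p) ε with hWε | hWε
    · refine (volume_inter_near_le hc hL0 hε (hV0 p) (hW0 p) hstep hlt ?_ ?_).trans ?_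
      · intro j hj x hx y hy
        simp only [hh]
        rw [sum_sub_sum_eq_integral_of_mem_cell hfg hper hint (hPn p hp) hj.le hx hy]
        exact abs_integral_sum_le_integral_cell (hPn p hp) hper hint hj.le hx hy
      · intro j x y hx hy hj
        have hjJ := (hlt j x hj).le
        have h1 := card_mul_le_integral_sum_shift_add (S := S) (α := α) (hPn p hp) hφ hφper hM
          hper hint hjJ hx hy
        simp only [hh]
        rw [sum_sub_sum_eq_integral_of_mem_cell hfg hper hint (hPn p hp) hjJ hx hy]
        refine le_trans ?_ h1
        gcongr
        have h2 : κ * J * |S| ≤ j * |S| := by gcongr; exact hge j x hj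
        linarith
      · apply ENNReal.ofReal_le_ofReal
        have h1 : (2 * ε + W p) / L ≤ K * ε / J := by
          calc (2 * ε + W p) / L ≤ (3 * ε) / L := by gcongr; linarith
            _ = K * ε / J := by rw [hL, hK]; field_simp; norm_num
        have h2 : (2 * ε + V p) / c + 1 ≤ V p / c + 3 := by
          have : ε / c ≤ 1 := (div_le_one hc).2 hεc
          rw [add_div, mul_div_assoc]
          linarith
        have h3 : 0 ≤ W p / (ε * J) := by have := hW0 p; positivity
        have h4 : 0 ≤ V p / c + 3 := by have := hV0 p; positivity
        have h5 : 0 ≤ (2 * ε + W p) / L := by have := hW0 p; positivity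
        have := mul_le_mul h2 h1 h5 h4
        linarith
    · refine (measure_mono Set.inter_subset_left).trans
        ((volume_cell_cutPoints_le hJ0 (hPn p hp)).trans (ENNReal.ofReal_le_ofReal ?_))
      have h1 : 1 / (J : ℝ) ≤ W p / (ε * J) := by
        rw [div_le_div_iff₀ hJr (by positivity)]
        nlinarith
      have h4 : 0 ≤ (V p / c + 3) * (K * ε / J) := by have := hV0 p; positivity
      linarith
  have hcover : Set.Ico 0 1 ∩ A ⊆ ⋃ p ∈ P, (cell P p ∩ A) := by
    rw [← biUnion_cell hP0 hPn]
    rintro x ⟨hx, hxA⟩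
    simp only [Set.mem_iUnion] at hx ⊢
    obtain ⟨p, hp, hx⟩ := hx
    exact ⟨p, hp, hx, hxA⟩
  calc volume (Set.Ico 0 1 ∩ A)
      ≤ ∑ p ∈ P, volume (cell P p ∩ A) :=
        (measure_mono hcover).trans (measure_biUnion_finset_le _ _)
    _ ≤ ∑ p ∈ P, ENNReal.ofReal ((V p / c + 3) * (K * ε / J) + W p / (ε * J)) :=
        Finset.sum_le_sum hcell
    _ = ENNReal.ofReal (∑ p ∈ P, ((V p / c + 3) * (K * ε / J) + W p / (ε * J))) := by
        rw [ENNReal.ofReal_sum_of_nonneg]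
        intro p _
        have := hV0 p
        have := hW0 p
        positivity
    _ ≤ _ := by
        apply ENNReal.ofReal_le_ofReal
        have hcard : (P.card : ℝ) ≤ (Z.card + 1) * J := by exact_mod_cast card_cutPoints_le Z α J
        rw [Finset.sum_add_distrib, ← Finset.sum_mul, Finset.sum_add_distrib, ← Finset.sum_div,
          ← Finset.sum_div, Finset.sum_const, nsmul_eq_mul, hVsum]
        calc (J * N / c + P.card * 3) * (K * ε / J) + (∑ p ∈ P, W p) / (ε * J)
            ≤ (J * N / c + ((Z.card + 1) * J) * 3) * (K * ε / J) + (J * ε ^ 2) / (ε * J) := by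
              gcongr
          _ = _ := by field_simp

theorem exists_lt_mem_Ico_of_mem {β : ℕ → ℝ} {x : ℝ} {n : ℕ} (hx : x ∈ Set.Ico (β 0) (β n)) :
    ∃ j < n, x ∈ Set.Ico (β j) (β (j + 1)) := by
  induction n with
  | zero => exact absurd (hx.1.trans_lt hx.2) (lt_irrefl _)
  | succ n ih =>
    rcases lt_or_ge x (β n) with h | h
    · obtain ⟨j, hj, hxj⟩ := ih ⟨hx.1, h⟩
      exact ⟨j, hj.trans (Nat.lt_succ_self n), hxj⟩
    · exact ⟨n, Nat.lt_succ_self n, h, hx.2⟩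

theorem exists_periodic_eqOn_Ico {β : ℕ → ℝ} {k : ℕ} (hβ : StrictMono β)
    (hk : β k = β 0 + 1) (G : ℕ → ℝ → ℝ) :
    ∃ g : ℝ → ℝ, Function.Periodic g 1 ∧
      ∀ j < k, Set.EqOn g (G j) (Set.Ico (β j) (β (j + 1))) := by
  refine ⟨fun x => ∑ j ∈ Finset.range k,
    (Set.Ico (β j) (β (j + 1))).indicator (G j) (β 0 + Int.fract (x - β 0)), fun x => ?_,
    fun j hj x hx => ?_⟩
  · simp only [show x + 1 - β 0 = x - β 0 + 1 by ring, Int.fract_add_one]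
  · have h0 : β 0 ≤ x := (hβ.monotone (Nat.zero_le j)).trans hx.1
    have h1 : x < β 0 + 1 := hk ▸ hx.2.trans_le (hβ.monotone hj)
    have h2 : β 0 + Int.fract (x - β 0) = x := by
      rw [Int.fract_eq_self.2 ⟨by linarith, by linarith⟩]
      ring
    simp only [h2]
    rw [Finset.sum_eq_single_of_mem j (Finset.mem_range.2 hj), Set.indicator_of_mem hx]
    intro i _ hij
    refine Set.indicator_of_notMem (fun hxi => ?_) _
    rcases lt_or_gt_of_ne hij with h | h
    · exact absurd (hxi.2.trans_le (hβ.monotone h)) (not_lt.2 hx.1)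
    · exact absurd (hx.2.trans_le (hβ.monotone h)) (not_lt.2 hxi.1)

theorem integral_congr_of_eqOn_Ico {g G : ℝ → ℝ} {a b : ℝ} (hab : a ≤ b)
    (h : Set.EqOn g G (Set.Ico a b)) : ∫ u in a..b, g u = ∫ u in a..b, G u := by
  rw [intervalIntegral.integral_of_le hab, intervalIntegral.integral_of_le hab,
    ← integral_Ico_eq_integral_Ioc, ← integral_Ico_eq_integral_Ioc]
  exact setIntegral_congr_fun measurableSet_Ico h

/-- A periodic piecewise absolutely continuous function is bounded and has a periodic integrable
derivative, whose mean is the sum of the jumps. -/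
theorem exists_derivative_of_piecewise {f : ℝ → ℝ} (hper : Function.Periodic f 1)
    (hpos : ∀ x, 0 < f x) {k : ℕ} {β : ℕ → ℝ} (hk : β k = β 0 + 1) (hβ : StrictMono β)
    {F : ℕ → ℝ → ℝ} (hF : ∀ j, AbsolutelyContinuousOn (F j) (β j) (β (j + 1)))
    (hfF : ∀ j, ∀ x ∈ Set.Ico (β j) (β (j + 1)), f x = F j x) :
    ∃ (g : ℝ → ℝ) (B : ℝ), Function.Periodic g 1 ∧ IntervalIntegrable g volume 0 1 ∧
      (∫ u in (0 : ℝ)..1, g u = ∑ j ∈ Finset.range k, (F j (β (j + 1)) - f (β (j + 1)))) ∧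
      (∀ x, f x ≤ B) ∧
      ∀ x y, x ≤ y → (∀ b ∈ (Finset.range k).image β, ∀ m : ℤ, b + m ∉ Set.Ioc x y) →
        f y - f x = ∫ u in x..y, g u := by
  choose G hGint hG using hF
  obtain ⟨g, hgper, hgG⟩ := exists_periodic_eqOn_Ico hβ hk G
  have hlt : ∀ j, β j < β (j + 1) := fun j => hβ j.lt_succ_self
  have hgi : ∀ j < k, IntervalIntegrable g volume (β j) (β (j + 1)) := by
    intro j hj
    rw [intervalIntegrable_iff_integrableOn_Ico_of_le (hlt j).le]
    exact ((intervalIntegrable_iff_integrableOn_Ico_of_le (hlt j).le).1 (hGint j)).congr_fun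
      (hgG j hj).symm measurableSet_Ico
  have hgi0 : IntervalIntegrable g volume (β 0) (β 0 + 1) := by
    rw [← hk]
    exact IntervalIntegrable.trans_iterate hgi
  have hgint : ∀ a b, IntervalIntegrable g volume a b :=
    fun a b => hgper.intervalIntegrable one_ne_zero hgi0 a b
  have hfβ : ∀ j, f (β j) = F j (β j) := fun j => hfF j _ ⟨le_rfl, hlt j⟩
  have hinc : ∀ j < k, ∀ x ∈ Set.Ico (β j) (β (j + 1)),
      f x = f (β j) + ∫ u in (β j)..x, g u := by
    intro j hj x hx
    rw [hfF j x hx, hG j x ⟨hx.1, hx.2.le⟩, hfβ, integral_congr_of_eqOn_Ico hx.1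
      ((hgG j hj).mono (Set.Ico_subset_Ico_right hx.2.le))]
  have hshift : ∀ x : ℝ, ∃ m : ℤ, ∃ j < k, x - m ∈ Set.Ico (β j) (β (j + 1)) := by
    intro x
    refine ⟨⌊x - β 0⌋, exists_lt_mem_Ico_of_mem ?_⟩
    have h1 := Int.floor_le (x - β 0)
    have h2 := Int.lt_floor_add_one (x - β 0)
    rw [hk]
    exact ⟨by linarith, by linarith⟩
  refine ⟨g, (∑ j ∈ Finset.range k, f (β j)) + ∫ u in (β 0)..(β 0 + 1), |g u|, hgper,
    hgint 0 1, ?_, ?_, ?_⟩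
  · have h1 : ∫ u in (0 : ℝ)..1, g u = ∫ u in (β 0)..(β k), g u := by
      have := hgper.intervalIntegral_add_eq 0 (β 0)
      rwa [zero_add, ← hk] at this
    rw [h1, ← intervalIntegral.sum_integral_adjacent_intervals fun j _ => hgint _ _]
    have h2 : ∀ j ∈ Finset.range k, ∫ u in (β j)..(β (j + 1)), g u =
        (F j (β (j + 1)) - f (β (j + 1))) + (f (β (j + 1)) - f (β j)) := by
      intro j hj
      rw [hG j (β (j + 1)) ⟨(hlt j).le, le_rfl⟩, hfβ j,
        integral_congr_of_eqOn_Ico (hlt j).le (hgG j (Finset.mem_range.1 hj))]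
      ring
    rw [Finset.sum_congr rfl h2, Finset.sum_add_distrib, Finset.sum_range_sub (fun j => f (β j)), hk, hper]
    ring
  · intro x
    obtain ⟨m, j, hj, hx⟩ := hshift x
    have h1 : f x = f (x - m) := by simpa using (hper.sub_int_mul_eq (x := x) m).symm
    rw [h1, hinc j hj _ hx]
    have h2 : f (β j) ≤ ∑ j ∈ Finset.range k, f (β j) :=
      Finset.single_le_sum (f := fun j => f (β j)) (fun i _ => (hpos _).le)
        (Finset.mem_range.2 hj)
    have h3 : ∫ u in (β j)..(x - m), g u ≤ ∫ u in (β 0)..(β 0 + 1), |g u| := by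
      refine (le_abs_self _).trans
        ((intervalIntegral.abs_integral_le_integral_abs hx.1).trans ?_)
      refine intervalIntegral.integral_mono_interval (hβ.monotone (Nat.zero_le j)) hx.1 ?_
        (ae_of_all _ fun u => abs_nonneg _) (hgint _ _).abs
      rw [← hk]
      exact hx.2.le.trans (hβ.monotone hj)
    exact add_le_add h2 h3
  · intro x y hxy hcut
    obtain ⟨m, j, hj, hx⟩ := hshift x
    have h1 : ∀ z, f z = f (z - m) := fun z => by
      simpa using (hper.sub_int_mul_eq (x := z) m).symm
    have h2 : ∀ z, g z = g (z - m) := fun z => by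
      simpa using (hgper.sub_int_mul_eq (x := z) m).symm
    have hy : y - m < β (j + 1) := by
      by_contra! hle
      rcases Nat.lt_or_ge (j + 1) k with hjk | hjk
      · exact hcut _ (Finset.mem_image_of_mem β (Finset.mem_range.2 hjk)) m
          ⟨by linarith [hx.2], by linarith⟩
      · have hjk' : j + 1 = k := le_antisymm hj hjk
        rw [hjk', hk] at hle
        have hx2 := hx.2
        rw [hjk', hk] at hx2
        refine hcut _ (Finset.mem_image_of_mem β (Finset.mem_range.2 (Nat.zero_lt_of_lt hj)))
          (m + 1) ⟨?_, ?_⟩ <;> push_cast <;> linarith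
    have hint := intervalIntegral.integral_comp_sub_right g (a := x) (b := y) (m : ℝ)
    simp_rw [← h2] at hint
    rw [hint, h1 x, h1 y, hinc j hj _ hx, hinc j hj (y - m) ⟨by linarith [hx.1], hy⟩,
      ← intervalIntegral.integral_add_adjacent_intervals (hgint (β j) (x - m))
        (hgint (x - m) (y - m))]
    ring

theorem periodic_comp_iterate_rotation {f T : ℝ → ℝ} {α : ℝ} (hper : Function.Periodic f 1)
    (hT : ∀ x, T x = Int.fract (x + α)) (i : ℕ) (x : ℝ) : f (T^[i] x) = f (x + i * α) := by
  have key : ∃ m : ℤ, T^[i] x = x + i * α - m := by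
    induction i with
    | zero => exact ⟨0, by simp⟩
    | succ i ih =>
      obtain ⟨m, hm⟩ := ih
      refine ⟨m + ⌊x + i * α - m + α⌋, ?_⟩
      rw [Function.iterate_succ_apply', hm, hT, Int.fract]
      push_cast
      ring
  obtain ⟨m, hm⟩ := key
  rw [hm]
  simpa using hper.sub_int_mul_eq (x := x + i * α) m

/-- The special flow over an ergodic irrational rotation, under a positive, bounded away
from zero, piecewise absolutely continuous roof function with non-zero sum of jumps, is
not partially rigid along any sequence `t_n → +∞`.  The circle is modelled as `[0,1)` with
Lebesgue measure, `T x = {x + α}`, and `f` is `1`-periodic with piecewise absolutely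
continuous data `(β, F, d)` as below. -/
theorem stmt_14 (α : ℝ) (hα : Irrational α)
    (T : ℝ → ℝ) (hT : ∀ x, T x = Int.fract (x + α))
    (ν : Measure ℝ) (hν : ν = volume.restrict (Set.Ico (0 : ℝ) 1))
    (f : ℝ → ℝ) (hper : ∀ x, f (x + 1) = f x)
    (c₀ : ℝ) (hc₀ : 0 < c₀) (hfc : ∀ x, c₀ ≤ f x)
    (k : ℕ) (hk : 1 ≤ k) (β : ℕ → ℝ) (hβper : ∀ j, β (j + k) = β j + 1)
    (hβmono : ∀ j, β j < β (j + 1)) (hβ0 : β 0 ∈ Set.Ico (0 : ℝ) 1)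
    (F : ℕ → ℝ → ℝ) (hF : ∀ j, AbsolutelyContinuousOn (F j) (β j) (β (j + 1)))
    (hfF : ∀ j, ∀ x ∈ Set.Ico (β j) (β (j + 1)), f x = F j x)
    (d : ℕ → ℝ) (hd : ∀ j, d j = F j (β (j + 1)) - f (β (j + 1)))
    (hS : (∑ j ∈ Finset.range k, d j) ≠ 0)
    -- the special flow space, measure, and flow (for positive times)
    (Xf : Set (ℝ × ℝ)) (hXf : Xf = {p : ℝ × ℝ | 0 ≤ p.2 ∧ p.2 < f p.1})
    (μf : Measure (ℝ × ℝ)) (hμf : μf = (ν.prod volume).restrict Xf)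
    (Tf : ℝ → ℝ × ℝ → ℝ × ℝ)
    (hTf : ∀ t : ℝ, 0 ≤ t → ∀ x : ℝ, ∀ s : ℝ, 0 ≤ s → s < f x →
      ∃ n : ℕ, (∑ i ∈ Finset.range n, f (T^[i] x)) ≤ s + t ∧
        s + t < (∑ i ∈ Finset.range (n + 1), f (T^[i] x)) ∧
        Tf t (x, s) = (T^[n] x, s + t - ∑ i ∈ Finset.range n, f (T^[i] x))) :
    ¬ ∃ (t : ℕ → ℝ) (u : ℝ), Tendsto t atTop atTop ∧ 0 < u ∧ u ≤ 1 ∧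
        ∀ D : Set (ℝ × ℝ), MeasurableSet D → D ⊆ Xf →
          ENNReal.ofReal u * μf D ≤ atTop.liminf fun n => μf (D ∩ Tf (t n) ⁻¹' D) := by
  rintro ⟨t, u, ht, hu, -, hrigid⟩
  obtain ⟨g, B, hgper, hgint, hgS, hfB, hfg⟩ := exists_derivative_of_piecewise hper
    (fun x => hc₀.trans_le (hfc x)) (by simpa using hβper 0) (strictMono_nat_of_lt_succ hβmono)
    hF hfF
  have hgS0 : ∫ v in (0 : ℝ)..1, g v ≠ 0 := by
    rw [hgS, ← Finset.sum_congr rfl fun j _ => hd j]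
    exact hS
  obtain ⟨C, hC, hsmall⟩ :=
    exists_eventually_volume_near_le hα hc₀ hfc hfB hgper hgint hgS0 hfg
  obtain ⟨ε, hε, hεc, hεu⟩ : ∃ ε, 0 < ε ∧ ε ≤ c₀ ∧ C * ε < u := by
    refine ⟨min c₀ (u / (2 * C)), by positivity, min_le_left _ _, ?_⟩
    calc C * min c₀ (u / (2 * C)) ≤ C * (u / (2 * C)) := by gcongr; exact min_le_right _ _
      _ = u / 2 := by field_simp
      _ < u := half_lt_self hu
  set D : Set (ℝ × ℝ) := Set.Ico 0 1 ×ˢ Set.Ico 0 ε with hD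
  have hDm : MeasurableSet D := measurableSet_Ico.prod measurableSet_Ico
  have hDX : D ⊆ Xf := by
    rintro ⟨x, s⟩ ⟨-, hs⟩
    rw [hXf]
    exact ⟨hs.1, hs.2.trans_le (hεc.trans (hfc x))⟩
  have hμD : μf D = ENNReal.ofReal ε := by
    rw [hμf, Measure.restrict_apply hDm, Set.inter_eq_left.2 hDX, hD, Measure.prod_prod, hν,
      Measure.restrict_apply_self]
    simp
  have hret : ∀ᶠ n in atTop, μf (D ∩ Tf (t n) ⁻¹' D) ≤ ENNReal.ofReal (C * ε * ε) := by
    filter_upwards [ht.eventually (hsmall ε hε hεc), ht.eventually (eventually_ge_atTop 0)]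
      with n hn hn0
    have hsub : D ∩ Tf (t n) ⁻¹' D ⊆ (Set.Ico 0 1 ∩
        {x | ∃ j : ℕ, |∑ i ∈ Finset.range j, f (x + i * α) - t n| < ε}) ×ˢ Set.Ico 0 ε := by
      rintro ⟨x, s⟩ ⟨⟨hx, hs⟩, hDt⟩
      have hsX : s < f x := hs.2.trans_le (hεc.trans (hfc x))
      obtain ⟨j, -, -, hj⟩ := hTf (t n) hn0 x s hs.1 hsX
      rw [Set.mem_preimage, hj] at hDt
      simp_rw [periodic_comp_iterate_rotation hper hT] at hDt
      have h1 := hDt.2.1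
      have h2 := hDt.2.2
      have h3 := hs.1
      have h4 := hs.2
      simp only at h1 h2 h3 h4
      exact ⟨⟨hx, j, by rw [abs_lt]; constructor <;> linarith⟩, hs⟩
    calc μf (D ∩ Tf (t n) ⁻¹' D)
        ≤ (ν.prod volume) (D ∩ Tf (t n) ⁻¹' D) := by
          rw [hμf]; exact Measure.restrict_apply_le _ _
      _ ≤ _ := measure_mono hsub
      _ ≤ ENNReal.ofReal (C * ε) * ENNReal.ofReal ε := by
          rw [Measure.prod_prod, Real.volume_Ico, sub_zero, hν]
          gcongr
          exact (Measure.restrict_apply_le _ _).trans hn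
      _ = _ := (ENNReal.ofReal_mul (by positivity)).symm
  have hle : ENNReal.ofReal u * ENNReal.ofReal ε ≤ ENNReal.ofReal (C * ε * ε) := by
    rw [← hμD]
    refine (hrigid D hDm hDX).trans ?_
    exact (liminf_le_liminf hret).trans_eq (by simp)
  rw [← ENNReal.ofReal_mul hu.le, ENNReal.ofReal_le_ofReal_iff (by positivity)] at hle
  nlinarith
end
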